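/- Let n ≥ 2 and suppose (1/p, 1/q) belongs to the interior of the region OCDA, or (1/p, 1/q) lies on the open segment (O, C) (i.e. p = ∞ and 1 < q < ∞). Let s be given by 2s = n − (2/q + n/p). Then there is a constant C such that for every family {f_j} of functions orthonormal in Ḣ^s(ℝⁿ) and every sequence {λ_j} ∈ ℓ^{q,1} one has ‖ Σ_j λ_j |e^{itΔ}f_j|² ‖_{L^{q,∞}(ℝ, L^p(ℝⁿ))} ≤ C ‖{λ_j}‖_{ℓ^{q,1}}. -/

import Mathlib

noncomputable section

open MeasureTheory ENNReal Real Set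

namespace OS

/-- `ℝⁿ` as a Euclidean space. -/
abbrev Rn (n : ℕ) := EuclideanSpace ℝ (Fin n)

/-- The real dot product `x·ξ`, viewed as a complex number. -/
def dotC {n : ℕ} (x ξ : Rn n) : ℂ := ((∑ i, x i * ξ i : ℝ) : ℂ)

/-- The Fourier transform `f̂(ξ) = ∫ f(x) e^{-i x·ξ} dx`. -/
def FT {n : ℕ} (f : Rn n → ℂ) (ξ : Rn n) : ℂ :=
  ∫ x : Rn n, Complex.exp (-(Complex.I * dotC x ξ)) * f x

/-- The propagator `e^{itΔ}` composed with a Fourier multiplier `m`: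
`x ↦ (2π)^{-n} ∫ e^{i(x·ξ - t|ξ|²)} m(ξ) f̂(ξ) dξ`. -/
def prop {n : ℕ} (m : Rn n → ℂ) (f : Rn n → ℂ) (t : ℝ) (x : Rn n) : ℂ :=
  ((2 * π : ℝ) ^ (-(n : ℝ)) : ℝ) •
    ∫ ξ : Rn n, Complex.exp (Complex.I * (dotC x ξ - (t : ℂ) * ((‖ξ‖ : ℝ) : ℂ) ^ 2)) *
      (m ξ * FT f ξ)

/-- The free Schrödinger propagator `e^{itΔ} f`, as a function of `(t, x)`. -/
def schrodinger {n : ℕ} (f : Rn n → ℂ) : ℝ → Rn n → ℂ := prop (fun _ => 1) f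

/-- The Fourier multiplier `|ξ|^{-s} ψ(2^{-k}|ξ|)` of `(-Δ)^{-s/2} P_k`. -/
def LPmult {n : ℕ} (s : ℝ) (ψ : ℝ → ℝ) (k : ℤ) (ξ : Rn n) : ℂ :=
  ((‖ξ‖ ^ (-s) * ψ ((2 : ℝ) ^ (-k) * ‖ξ‖) : ℝ) : ℂ)

/-- The Littlewood–Paley projection `P_k h`. -/
def LP {n : ℕ} (ψ : ℝ → ℝ) (k : ℤ) (h : Rn n → ℂ) (x : Rn n) : ℂ :=
  ((2 * π : ℝ) ^ (-(n : ℝ)) : ℝ) •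
    ∫ ξ : Rn n, Complex.exp (Complex.I * dotC x ξ) *
      (((ψ ((2 : ℝ) ^ (-k) * ‖ξ‖) : ℝ) : ℂ) * FT h ξ)

/-- The standing hypotheses on the Littlewood–Paley bump function `ψ`:
smooth, `[0,1]`-valued, supported in `[1/2,2]`, with `∑_{k∈ℤ} ψ(2^{-k} r) = 1` for `r ≠ 0`. -/
structure IsLPF (ψ : ℝ → ℝ) : Prop where
  smooth : ContDiff ℝ (⊤ : ℕ∞) ψ
  mem_Icc : ∀ r, ψ r ∈ Icc (0 : ℝ) 1
  supp : Function.support ψ ⊆ Icc (1 / 2 : ℝ) 2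
  sum_one : ∀ r : ℝ, r ≠ 0 → ∑' k : ℤ, ψ ((2 : ℝ) ^ (-k) * r) = 1

/-- Orthonormality in `L²(ℝⁿ)`. -/
def OrthonormalL2 {n : ℕ} (f : ℕ → Rn n → ℂ) : Prop :=
  ∀ j k, (∫ x : Rn n, f j x * (starRingEnd ℂ) (f k x)) = if j = k then 1 else 0

/-- Orthonormality in the homogeneous Sobolev space `Ḣ^s(ℝⁿ)`:
`(2π)^{-n} ∫ |ξ|^{2s} f̂_j(ξ) conj(f̂_k(ξ)) dξ = δ_{jk}`. -/
def OrthonormalHs {n : ℕ} (s : ℝ) (f : ℕ → Rn n → ℂ) : Prop :=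
  ∀ j k, ((2 * π : ℝ) ^ (-(n : ℝ)) : ℝ) •
    (∫ ξ : Rn n, ((‖ξ‖ ^ (2 * s) : ℝ) : ℂ) * (FT (f j) ξ * (starRingEnd ℂ) (FT (f k) ξ)))
      = if j = k then 1 else 0

/-- The density `Σ_j λ_j |u_j(t,x)|²` of a system of space-time functions. -/
def density2 {n : ℕ} (lam : ℕ → ℝ) (u : ℕ → ℝ → Rn n → ℂ) (t : ℝ) (x : Rn n) : ℝ :=
  ∑' j, lam j * ‖u j t x‖ ^ 2

/-- The density `Σ_j λ_j |e^{itΔ}f_j(x)|²`. -/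
def density {n : ℕ} (lam : ℕ → ℝ) (f : ℕ → Rn n → ℂ) : ℝ → Rn n → ℝ :=
  density2 lam fun j => schrodinger (f j)

/-- The `L^q` norm (w.r.t. `μ`) of an `ℝ≥0∞`-valued function. -/
def eLp {α : Type*} [MeasurableSpace α] (μ : Measure α) (q : ℝ≥0∞) (F : α → ℝ≥0∞) : ℝ≥0∞ :=
  if q = ∞ then essSup F μ
  else (∫⁻ t, F t ^ q.toReal ∂μ) ^ (1 / q.toReal)

/-- The Lorentz `L^{p,r}` (quasi)norm of an `ℝ≥0∞`-valued function, via the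
distribution function.  For `r = ∞` this is the weak-`L^p` quasinorm
`sup_{s>0} s μ(G > s)^{1/p} = sup_{t>0} t^{1/p} G^*(t)`. -/
def lor {α : Type*} [MeasurableSpace α] (μ : Measure α) (p r : ℝ≥0∞) (G : α → ℝ≥0∞) : ℝ≥0∞ :=
  if p = ∞ then essSup G μ
  else if r = ∞ then
    ⨆ (s : ℝ) (_ : 0 < s), ENNReal.ofReal s * μ {x | ENNReal.ofReal s < G x} ^ (1 / p.toReal)
  else
    (∫⁻ s in Ioi (0 : ℝ),
      (ENNReal.ofReal s * μ {x | ENNReal.ofReal s < G x} ^ (1 / p.toReal)) ^ r.toReal *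
        (ENNReal.ofReal s)⁻¹) ^ (1 / r.toReal)

/-- The mixed norm `‖u‖_{L^q(ℝ, L^p(ℝⁿ))}`. -/
def mixedLp {n : ℕ} {E : Type*} [NormedAddCommGroup E] (q p : ℝ≥0∞)
    (u : ℝ → Rn n → E) : ℝ≥0∞ :=
  eLp volume q fun t => eLpNorm (u t) p volume

/-- The mixed norm `‖u‖_{L^{q,∞}(ℝ, L^p(ℝⁿ))}` (weak in time). -/
def mixedWeakLp {n : ℕ} {E : Type*} [NormedAddCommGroup E] (q p : ℝ≥0∞)
    (u : ℝ → Rn n → E) : ℝ≥0∞ :=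
  lor volume q ∞ fun t => eLpNorm (u t) p volume

/-- The weak `L^{p,∞}(ℝⁿ)` quasinorm. -/
def wLp {n : ℕ} {E : Type*} [NormedAddCommGroup E] (p : ℝ≥0∞) (g : Rn n → E) : ℝ≥0∞ :=
  lor volume p ∞ fun x => (‖g x‖₊ : ℝ≥0∞)

/-- The mixed Lorentz norm `‖u‖_{L^{q,r}(ℝ, L^{p,r̃}(ℝⁿ))}`. -/
def mixedLorentz {n : ℕ} {E : Type*} [NormedAddCommGroup E] (q r p rt : ℝ≥0∞)
    (u : ℝ → Rn n → E) : ℝ≥0∞ :=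
  lor volume q r fun t => lor volume p rt fun x => (‖u t x‖₊ : ℝ≥0∞)

/-- The `ℓ^a` norm of a sequence (with `ℓ^∞` the supremum norm). -/
def seqNormE (a : ℝ≥0∞) (lam : ℕ → ℝ) : ℝ≥0∞ :=
  if a = ∞ then ⨆ j, ENNReal.ofReal |lam j|
  else (∑' j, ENNReal.ofReal |lam j| ^ a.toReal) ^ (1 / a.toReal)

/-- The decreasing rearrangement of a sequence: `seqRearr lam j` is the
`(j+1)`-th largest value of `|lam i|`. -/
def seqRearr (lam : ℕ → ℝ) (j : ℕ) : ℝ≥0∞ :=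
  sInf {s : ℝ≥0∞ | Measure.count {i : ℕ | s < ENNReal.ofReal |lam i|} ≤ (j : ℝ≥0∞)}

/-- The Lorentz sequence norm `‖lam‖_{ℓ^{q,r}} = (Σ_j (j^{1/q} λ*_j)^r / j)^{1/r}`,
parametrized by `qinv = 1/q` and a finite second exponent `r`. -/
def seqLor (qinv r : ℝ) (lam : ℕ → ℝ) : ℝ≥0∞ :=
  (∑' j : ℕ, (((j : ℝ≥0∞) + 1) ^ qinv * seqRearr lam j) ^ r * ((j : ℝ≥0∞) + 1)⁻¹) ^ (1 / r)

/-- The interior of the triangle `OAB`, in the coordinates `(a, b) = (1/p, 1/q)`. -/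
def IntOAB (n : ℕ) (a b : ℝ) : Prop :=
  a ∈ Ioo (0 : ℝ) 1 ∧ b ∈ Ioo (0 : ℝ) 1 ∧ b < (n : ℝ) / (n - 1) * a ∧ 2 * b + n * a < n

/-- The interior of the quadrilateral `OCDA`, in the coordinates `(a, b) = (1/p, 1/q)`. -/
def IntOCDA (n : ℕ) (a b : ℝ) : Prop :=
  a ∈ Ioo (0 : ℝ) 1 ∧ b ∈ Ioo (0 : ℝ) 1 ∧ (n : ℝ) / (n - 1) * a < b ∧ 2 * b + n * a < n

def ptO : ℝ × ℝ := (0, 0)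
def ptA (n : ℕ) : ℝ × ℝ := (((n : ℝ) - 1) / (n + 1), (n : ℝ) / (n + 1))
def ptB : ℝ × ℝ := (1, 0)
def ptC : ℝ × ℝ := (0, 1)
def ptD (n : ℕ) : ℝ × ℝ := (((n : ℝ) - 2) / n, 1)

/-- The closed triangle `OAB`. -/
def OAB (n : ℕ) : Set (ℝ × ℝ) := convexHull ℝ {ptO, ptA n, ptB}

/-- The closed quadrilateral `OCDA`. -/
def OCDA (n : ℕ) : Set (ℝ × ℝ) := convexHull ℝ {ptO, ptC, ptD n, ptA n}

/-- The half-open segment `[A, D)`. -/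
def segAD (n : ℕ) : Set (ℝ × ℝ) := {x | ∃ t ∈ Ico (0 : ℝ) 1, x = (1 - t) • ptA n + t • ptD n}

/-- The Lebesgue exponent with reciprocal `a` (so `expOf 0 = ∞`). -/
def expOf (a : ℝ) : ℝ≥0∞ := (ENNReal.ofReal a)⁻¹

/-- The weighted velocity average `∫ f(x - tv, v) |v|^{-2s} dv` of the solution of
the kinetic transport equation with datum `f`. -/
def velAvg {n : ℕ} (s : ℝ) (f : Rn n × Rn n → ℂ) (t : ℝ) (x : Rn n) : ℂ :=
  ∫ v : Rn n, ((‖v‖ ^ (-(2 * s)) : ℝ) : ℂ) * f (x - t • v, v)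

end OS

open OS

theorem sq_sum_sq_inner_le_of_bessel {H Y J : Type*} [NormedAddCommGroup H] [InnerProductSpace ℂ H]
    [Fintype Y] (I : Finset J) (v : Y → H) (h : J → H)
    (hB : ∀ x, ∑ j ∈ I, ‖inner ℂ (h j) x‖ ^ 2 ≤ ‖x‖ ^ 2)
    (near : Y → Y → Prop) [∀ y y', Decidable (near y y')] (P F : ℝ)
    (hP : ∀ c : Y → ℂ, ‖∑ y, ∑ y', if near y y' then inner ℂ (c y • v y) (c y' • v y') else 0‖
      ≤ P * ∑ y, ‖c y‖ ^ 2)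
    (hF : ∑ y, ∑ y', (if near y y' then 0 else ‖(inner ℂ (v y) (v y') : ℂ)‖ ^ 2) ≤ F) :
    (∑ j ∈ I, ∑ y, ‖(inner ℂ (v y) (h j) : ℂ)‖ ^ 2) ^ 2 ≤
      I.card * (2 * P * (∑ j ∈ I, ∑ y, ‖(inner ℂ (v y) (h j) : ℂ)‖ ^ 2) + F) := by
  set c : J → Y → ℂ := fun j y => inner ℂ (v y) (h j) with hc
  set S : ℝ := ∑ j ∈ I, ∑ y, ‖c j y‖ ^ 2 with hS
  set G : J → H := fun j => ∑ y, c j y • v y with hG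
  set T : ℝ := ∑ j ∈ I, ‖G j‖ ^ 2 with hT
  set D : Y → Y → ℂ := fun y y' => ∑ j ∈ I, (starRingEnd ℂ) (c j y) * c j y' with hD
  have h1 : ∀ j ∈ I, ‖h j‖ ≤ 1 := by
    intro j hj
    have := (Finset.single_le_sum (f := fun i => ‖(inner ℂ (h i) (h j) : ℂ)‖ ^ 2)
      (fun i _ => by positivity) hj).trans (hB (h j))
    simp only [inner_self_eq_norm_sq_to_K] at this
    simp at this
    by_contra hcon
    push Not at hcon
    nlinarith [sq_nonneg (‖h j‖), mul_self_nonneg (‖h j‖ ^ 2 - 1), sq_nonneg (‖h j‖-1)]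
  have hSG : S ≤ ∑ j ∈ I, ‖G j‖ := by
    refine Finset.sum_le_sum fun j hj => ?_
    have e : (inner ℂ (G j) (h j) : ℂ) = ((∑ y, ‖c j y‖ ^ 2 : ℝ) : ℂ) := by
      simp only [hG, sum_inner, inner_smul_left]
      push_cast
      refine Finset.sum_congr rfl fun y _ => ?_
      rw [← Complex.conj_mul']
    have e2 : ‖(inner ℂ (G j) (h j) : ℂ)‖ = ∑ y, ‖c j y‖ ^ 2 := by
      rw [e, Complex.norm_real, Real.norm_of_nonneg (by positivity)]
    rw [← e2]
    refine (norm_inner_le_norm _ _).trans ?_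
    exact mul_le_of_le_one_right (norm_nonneg _) (h1 j hj)
  have hS0 : 0 ≤ S := by positivity
  have hST : S ^ 2 ≤ I.card * T := by
    calc S ^ 2 ≤ (∑ j ∈ I, ‖G j‖) ^ 2 := by gcongr
      _ ≤ _ := by
        exact sq_sum_le_card_mul_sum_sq
  have hZ : ∑ y, ∑ y', ‖D y y'‖ ^ 2 ≤ T := by
    have e1 : ∑ y, ∑ y', ‖D y y'‖ ^ 2 = ∑ j ∈ I, ∑ l ∈ I, ‖(inner ℂ (h l) (G j) : ℂ)‖ ^ 2 := by
      have : ((∑ y, ∑ y', ‖D y y'‖ ^ 2 : ℝ) : ℂ) =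
          ((∑ j ∈ I, ∑ l ∈ I, ‖(inner ℂ (h l) (G j) : ℂ)‖ ^ 2 : ℝ) : ℂ) := by
        push_cast
        have eA : ∀ j l, (inner ℂ (h l) (G j) : ℂ) = ∑ y, (starRingEnd ℂ) (c l y) * c j y := by
          intro j l
          simp only [hG, inner_sum, inner_smul_right, hc, inner_conj_symm]
          exact Finset.sum_congr rfl fun y _ => mul_comm _ _
        simp only [eA, ← Complex.conj_mul', hD, map_sum, map_mul, Complex.conj_conj,
          Finset.sum_mul_sum]
        calc _ = ∑ y, ∑ j ∈ I, ∑ y', ∑ l ∈ I,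
              c j y * (starRingEnd ℂ) (c j y') * ((starRingEnd ℂ) (c l y) * c l y') := by
              refine Finset.sum_congr rfl fun y _ => ?_
              rw [Finset.sum_comm]
          _ = ∑ j ∈ I, ∑ y, ∑ l ∈ I, ∑ y', 
              c j y * (starRingEnd ℂ) (c j y') * ((starRingEnd ℂ) (c l y) * c l y') := by
              rw [Finset.sum_comm]
              refine Finset.sum_congr rfl fun j _ => Finset.sum_congr rfl fun y _ => ?_
              rw [Finset.sum_comm]
          _ = ∑ j ∈ I, ∑ l ∈ I, ∑ y, ∑ y', 
              c j y * (starRingEnd ℂ) (c j y') * ((starRingEnd ℂ) (c l y) * c l y') := by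
              refine Finset.sum_congr rfl fun j _ => ?_
              rw [Finset.sum_comm]
          _ = _ := by
              refine Finset.sum_congr rfl fun j _ => Finset.sum_congr rfl fun l _ => ?_
              rw [Finset.sum_comm]
              refine Finset.sum_congr rfl fun y _ => Finset.sum_congr rfl fun y' _ => ?_
              ring
      exact_mod_cast this
    rw [e1]
    exact Finset.sum_le_sum fun j _ => hB _
  have hT2 : T ≤ 2 * P * S + F := by
    have e : (T : ℂ) = ∑ j ∈ I, (∑ y, ∑ y', if near y y' then
          (inner ℂ (c j y • v y) (c j y' • v y') : ℂ) else 0) +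
        ∑ y, ∑ y', (if near y y' then 0 else D y y' * inner ℂ (v y) (v y')) := by
      have e0 : ∀ j, ((‖G j‖ ^ 2 : ℝ) : ℂ) = (∑ y, ∑ y', if near y y' then
          (inner ℂ (c j y • v y) (c j y' • v y') : ℂ) else 0) + 
          ∑ y, ∑ y', (if near y y' then 0 else (starRingEnd ℂ) (c j y) * c j y' *
            inner ℂ (v y) (v y')) := by
        intro j
        have := inner_self_eq_norm_sq_to_K (𝕜 := ℂ) (G j)
        push_cast
        rw [show ((‖G j‖ : ℂ) ^ 2) = inner ℂ (G j) (G j) from this.symm, ← Finset.sum_add_distrib]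
        simp only [hG]
        rw [sum_inner]
        refine Finset.sum_congr rfl fun y _ => ?_
        rw [inner_sum, ← Finset.sum_add_distrib]
        refine Finset.sum_congr rfl fun y' _ => ?_
        split_ifs
        · exact (add_zero _).symm
        · rw [zero_add, inner_smul_left, inner_smul_right, mul_assoc]
      rw [hT]
      push_cast
      rw [Finset.sum_congr rfl (fun j _ => by have := e0 j; push_cast at this; exact this),
        Finset.sum_add_distrib]
      congr 1
      rw [Finset.sum_comm]
      refine Finset.sum_congr rfl fun y _ => ?_
      rw [Finset.sum_comm]
      refine Finset.sum_congr rfl fun y' _ => ?_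
      split_ifs
      · simp
      · simp only [hD, Finset.sum_mul]
    have n1 : T ≤ P * S + ((∑ y, ∑ y', ‖D y y'‖ ^ 2) + F) / 2 := by
      have hT0 : 0 ≤ T := by positivity
      calc T = ‖(T : ℂ)‖ := by rw [Complex.norm_real, Real.norm_of_nonneg hT0]
        _ ≤ ∑ j ∈ I, P * ∑ y, ‖c j y‖ ^ 2 + 
          ∑ y, ∑ y', (‖D y y'‖ ^ 2 + (if near y y' then 0 else
            ‖(inner ℂ (v y) (v y') : ℂ)‖ ^ 2)) / 2 := by
            rw [e]
            refine (norm_add_le _ _).trans (add_le_add ?_ ?_)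
            · exact (norm_sum_le _ _).trans (Finset.sum_le_sum fun j _ => hP _)
            · refine (norm_sum_le _ _).trans (Finset.sum_le_sum fun y _ => ?_)
              refine (norm_sum_le _ _).trans (Finset.sum_le_sum fun y' _ => ?_)
              split_ifs
              · simp; positivity
              · rw [norm_mul]
                nlinarith [sq_nonneg (‖D y y'‖ - ‖(inner ℂ (v y) (v y') : ℂ)‖)]
        _ ≤ _ := by
            simp only [← Finset.sum_div, Finset.sum_add_distrib]
            rw [← Finset.mul_sum]
            linarith
    linarith
  calc S ^ 2 ≤ I.card * T := hST
    _ ≤ _ := by gcongr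

theorem sum_le_two_mul_sum_floor {ι : Type*} (K : Finset ι) (t : ι → ℝ) (x : ℝ)
    (hsep : ∀ i k, i ≠ k → 1 ≤ |t i - t k|) (T : Finset ℕ) (G : ℕ → ℝ) (hG : ∀ z, 0 ≤ G z)
    (g : ι → ℝ) (hT : ∀ k ∈ K, ⌊|t k - x|⌋₊ ∈ T) (hg : ∀ k ∈ K, g k ≤ G ⌊|t k - x|⌋₊) :
    ∑ k ∈ K, g k ≤ 2 * ∑ z ∈ T, G z := by
  classical
  calc ∑ k ∈ K, g k ≤ ∑ k ∈ K, G ⌊|t k - x|⌋₊ := Finset.sum_le_sum hg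
    _ = ∑ z ∈ T, ∑ k ∈ K with ⌊|t k - x|⌋₊ = z, G ⌊|t k - x|⌋₊ :=
      (Finset.sum_fiberwise_of_maps_to hT _).symm
    _ ≤ ∑ z ∈ T, 2 * G z := by
      refine Finset.sum_le_sum fun z _ => ?_
      have hc : (K.filter fun k => ⌊|t k - x|⌋₊ = z).card ≤ 2 := by
        have := Finset.card_le_card_of_injOn (s := K.filter fun k => ⌊|t k - x|⌋₊ = z)
          (t := (Finset.univ : Finset Bool)) (fun k => decide (0 ≤ t k - x)) (fun _ _ => Finset.mem_coe.2 (Finset.mem_univ _)) (by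
            intro i hi k hk hik
            by_contra hne
            have h1 := hsep i k hne
            simp only [Finset.coe_filter, Set.mem_ofPred_eq] at hi hk
            have a1 := Nat.floor_le (abs_nonneg (t i - x))
            have a2 := Nat.lt_floor_add_one (|t i - x|)
            have b1 := Nat.floor_le (abs_nonneg (t k - x))
            have b2 := Nat.lt_floor_add_one (|t k - x|)
            rw [hi.2] at a1 a2
            rw [hk.2] at b1 b2
            simp only [decide_eq_decide] at hik
            rcases le_total 0 (t i - x) with h | h
            · have h' := hik.1 h
              rw [abs_of_nonneg h] at a1 a2
              rw [abs_of_nonneg h'] at b1 b2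
              rcases abs_cases (t i - t k) with h3 | h3 <;> linarith
            · rcases le_or_gt 0 (t k - x) with h' | h'
              · have := hik.2 h'
                rw [abs_of_nonneg this] at a1 a2
                rw [abs_of_nonneg h'] at b1 b2
                rcases abs_cases (t i - t k) with h3 | h3 <;> linarith
              · rw [abs_of_nonpos h] at a1 a2
                rw [abs_of_neg h'] at b1 b2
                rcases abs_cases (t i - t k) with h3 | h3 <;> linarith)
        simpa using this
      calc _ = ∑ k ∈ K with ⌊|t k - x|⌋₊ = z, G z := by
            refine Finset.sum_congr rfl fun k hk => ?_
            rw [(Finset.mem_filter.1 hk).2]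
        _ ≤ _ := by
            rw [Finset.sum_const, nsmul_eq_mul]
            exact mul_le_mul_of_nonneg_right (by exact_mod_cast hc) (hG z)
    _ = _ := by rw [Finset.mul_sum]

theorem sum_range_rpow_le {κ : ℝ} (h0 : 0 < κ) (h1 : κ ≤ 1) (Z : ℕ) :
    ∑ z ∈ Finset.range Z, (1 + (z : ℝ)) ^ (κ - 1) ≤ (Z : ℝ) ^ κ / κ := by
  induction Z with
  | zero => simp [Real.zero_rpow h0.ne']
  | succ Z ih =>
    rw [Finset.sum_range_succ]
    have hp : (0 : ℝ) < (Z : ℝ) + 1 := by positivity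
    have hb := rpow_one_add_le_one_add_mul_self (s := -(1 / ((Z : ℝ) + 1)))
      (by rw [neg_le_neg_iff, div_le_one hp]; linarith [(Nat.cast_nonneg Z : (0 : ℝ) ≤ Z)]) h0.le h1
    have e1 : 1 + -(1 / ((Z : ℝ) + 1)) = Z / (Z + 1) := by field_simp; ring
    rw [e1, Real.div_rpow (by positivity) hp.le, div_le_iff₀ (by positivity)] at hb
    have e2 : (1 + (Z : ℝ)) ^ (κ - 1) = ((Z : ℝ) + 1) ^ κ / (Z + 1) := by
      rw [add_comm, Real.rpow_sub hp, Real.rpow_one]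
    rw [e2]
    push_cast
    have : ((Z : ℝ) + 1) ^ κ / (Z + 1) = (((Z : ℝ) + 1) ^ κ -
        ((1 + κ * -(1 / ((Z : ℝ) + 1))) * ((Z : ℝ) + 1) ^ κ)) / κ := by
      field_simp; ring
    rw [this]
    calc _ ≤ (Z : ℝ) ^ κ / κ + (((Z : ℝ) + 1) ^ κ - (Z : ℝ) ^ κ) / κ := by gcongr
      _ = _ := by ring

theorem sum_near_rpow_le {ι : Type*} (K : Finset ι) (t : ι → ℝ) (x : ℝ)
    (hsep : ∀ i k, i ≠ k → 1 ≤ |t i - t k|) {κ R : ℝ} (h0 : 0 < κ) (h1 : κ ≤ 1) (hR : 1 ≤ R) :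
    ∑ k ∈ K with |t k - x| ≤ R, (1 + |t k - x|) ^ (κ - 1) ≤ 4 / κ * R ^ κ := by
  refine (sum_le_two_mul_sum_floor _ t x hsep (Finset.range (⌊R⌋₊ + 1))
    (fun z => (1 + (z : ℝ)) ^ (κ - 1)) (fun z => by positivity) _ ?_ ?_).trans ?_
  · intro k hk
    rw [Finset.mem_range, Nat.lt_succ_iff]
    exact Nat.floor_le_floor (Finset.mem_filter.1 hk).2
  · intro k _
    refine Real.rpow_le_rpow_of_nonpos (by positivity) ?_ (by linarith)
    gcongr
    exact Nat.floor_le (abs_nonneg _)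
  · have h2 := sum_range_rpow_le h0 h1 (⌊R⌋₊ + 1)
    have h3 : ((⌊R⌋₊ + 1 : ℕ) : ℝ) ^ κ ≤ 2 * R ^ κ := by
      calc ((⌊R⌋₊ + 1 : ℕ) : ℝ) ^ κ ≤ (2 * R) ^ κ := by
            refine Real.rpow_le_rpow (by positivity) ?_ h0.le
            push_cast
            linarith [Nat.floor_le (by linarith : 0 ≤ R)]
        _ = 2 ^ κ * R ^ κ := by rw [Real.mul_rpow (by norm_num) (by linarith)]
        _ ≤ 2 ^ (1 : ℝ) * R ^ κ := by
            gcongr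
            norm_num
        _ = _ := by norm_num
    calc _ ≤ 2 * ((2 * R ^ κ) / κ) := by
          gcongr
          exact h2.trans (by gcongr)
      _ = _ := by ring

theorem sum_far_rpow_le {ι : Type*} (K : Finset ι) (t : ι → ℝ) (x : ℝ)
    (hsep : ∀ i k, i ≠ k → 1 ≤ |t i - t k|) {n : ℕ} (hn : 2 ≤ n) {R : ℝ} (hR : 1 ≤ R) :
    ∑ k ∈ K with ¬ |t k - x| ≤ R, (1 + |t k - x|) ^ (-(n : ℝ)) ≤ 4 * R ^ (1 - (n : ℝ)) := by
  have hR0 : 0 < R := by linarith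
  have hn' : (2 : ℝ) ≤ n := by exact_mod_cast hn
  obtain ⟨Z, hZ⟩ : ∃ Z : ℕ, ∀ k ∈ K, ⌊|t k - x|⌋₊ < Z :=
    ⟨K.sup (fun k => ⌊|t k - x|⌋₊) + 1, fun k hk =>
      Nat.lt_succ_iff.2 (Finset.le_sup (f := fun k => ⌊|t k - x|⌋₊) hk)⟩
  have key := sum_le_two_mul_sum_floor (K.filter fun k => ¬ |t k - x| ≤ R) t x hsep
    (Finset.Ico ⌊R⌋₊ Z) (fun z => R ^ (2 - (n : ℝ)) * (((z + 1 : ℕ) : ℝ) ^ 2)⁻¹)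
    (fun z => by positivity) (fun k => (1 + |t k - x|) ^ (-(n : ℝ))) (by
      intro k hk
      rw [Finset.mem_filter] at hk
      rw [Finset.mem_Ico]
      exact ⟨Nat.floor_le_floor (not_le.1 hk.2).le, hZ k hk.1⟩) (by
      intro k hk
      have hk2 := not_le.1 (Finset.mem_filter.1 hk).2
      have hp : 0 < 1 + |t k - x| := by positivity
      have : (1 + |t k - x|) ^ (-(n : ℝ)) =
          (1 + |t k - x|) ^ (2 - (n : ℝ)) * ((1 + |t k - x|) ^ 2)⁻¹ := by
        rw [← Real.rpow_natCast, ← Real.rpow_neg hp.le, ← Real.rpow_add hp]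
        congr 1; push_cast; ring
      rw [this]
      gcongr ?_ * (?_)⁻¹
      · exact Real.rpow_le_rpow_of_nonpos hR0 (by linarith) (by linarith)
      · push_cast
        refine pow_le_pow_left₀ (by positivity) ?_ 2
        linarith [Nat.floor_le (abs_nonneg (t k - x))])
  refine key.trans ?_
  rw [← Finset.mul_sum]
  have h2 : ∑ z ∈ Finset.Ico ⌊R⌋₊ Z, (((z + 1 : ℕ) : ℝ) ^ 2)⁻¹ ≤ 2 / R := by
    rw [Finset.sum_Ico_add' (fun i : ℕ => ((i : ℝ) ^ 2)⁻¹) ⌊R⌋₊ Z 1]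
    have := sum_Ioo_inv_sq_le (α := ℝ) ⌊R⌋₊ (Z + 1)
    refine le_trans (le_of_eq ?_) (this.trans ?_)
    · refine Finset.sum_congr ?_ fun _ _ => rfl
      ext i; simp
    · gcongr
      exact (Nat.lt_floor_add_one R).le
  have e : R ^ (1 - (n : ℝ)) = R ^ (2 - (n : ℝ)) * R⁻¹ := by
    rw [← Real.rpow_neg_one, ← Real.rpow_add hR0]; congr 1; ring
  rw [e]
  calc _ ≤ 2 * (R ^ (2 - (n : ℝ)) * (2 / R)) := by gcongr
    _ = _ := by ring

theorem sum_mul_mul_le_of_symm {ι : Type*} [Fintype ι] (w : ι → ι → ℝ) (e : ι → ℝ) (W : ℝ)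
    (hw : ∀ i k, 0 ≤ w i k) (hs : ∀ i k, w i k = w k i) (hW : ∀ i, ∑ k, w i k ≤ W) :
    ∑ i, ∑ k, w i k * e i * e k ≤ W * ∑ i, e i ^ 2 := by
  calc ∑ i, ∑ k, w i k * e i * e k ≤ ∑ i, ∑ k, (w i k * e i ^ 2 / 2 + w i k * e k ^ 2 / 2) := by
        refine Finset.sum_le_sum fun i _ => Finset.sum_le_sum fun k _ => ?_
        nlinarith [mul_nonneg (hw i k) (sq_nonneg (e i - e k))]
    _ = ∑ i, ∑ k, w i k * e i ^ 2 / 2 + ∑ i, ∑ k, w i k * e k ^ 2 / 2 := by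
        simp only [Finset.sum_add_distrib]
    _ = ∑ i, ∑ k, w i k * e i ^ 2 := by
        have : ∑ i, ∑ k, w i k * e k ^ 2 / 2 = ∑ i, ∑ k, w i k * e i ^ 2 / 2 := by
          rw [Finset.sum_comm]
          simp only [hs]
        rw [this, ← two_mul]
        simp only [← Finset.sum_div]
        ring
    _ ≤ ∑ i, W * e i ^ 2 := by
        refine Finset.sum_le_sum fun i _ => ?_
        rw [← Finset.sum_mul]
        exact mul_le_mul_of_nonneg_right (hW i) (sq_nonneg _)
    _ = _ := by rw [Finset.mul_sum]

theorem sq_sum_sq_inner_le_of_dispersive {H : Type*} [NormedAddCommGroup H]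
    [InnerProductSpace ℂ H] {n : ℕ} (hn : 2 ≤ n) {κ θ : ℝ} (hκ0 : 0 < κ) (hκ1 : κ ≤ 1)
    (hθ : θ = 2 / n * (1 - κ)) {M L : ℕ} (t : Fin M → ℝ)
    (hsep : ∀ i k, i ≠ k → 1 ≤ |t i - t k|) (v : Fin M → Fin L → H)
    (hdisp : ∀ i l k l', ‖(inner ℂ (v i l) (v k l') : ℂ)‖ ≤ (1 + |t i - t k|) ^ (-(n : ℝ) / 2))
    (hsame : ∀ i l, ∑ l', ‖(inner ℂ (v i l) (v i l') : ℂ)‖ ≤ 1)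
    {J : Type*} (I : Finset J) (h : J → H)
    (hB : ∀ x, ∑ j ∈ I, ‖inner ℂ (h j) x‖ ^ 2 ≤ ‖x‖ ^ 2) {R : ℝ} (hR : 1 ≤ R) :
    (∑ j ∈ I, ∑ y : Fin M × Fin L, ‖(inner ℂ (v y.1 y.2) (h j) : ℂ)‖ ^ 2) ^ 2 ≤
      I.card * (2 * ((L : ℝ) ^ θ * (4 / κ * R ^ κ)) *
        (∑ j ∈ I, ∑ y : Fin M × Fin L, ‖(inner ℂ (v y.1 y.2) (h j) : ℂ)‖ ^ 2) +
        M * (L ^ 2 * (4 * R ^ (1 - (n : ℝ))))) := by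
  have hn0 : (2 : ℝ) ≤ n := by exact_mod_cast hn
  have hθ0 : 0 ≤ θ := by rw [hθ]; exact mul_nonneg (by positivity) (by linarith)
  have hθ1 : θ ≤ 1 := by
    rw [hθ]
    have : 2 / (n : ℝ) ≤ 1 := by rw [div_le_one (by linarith)]; exact hn0
    nlinarith [show (0 : ℝ) ≤ 2 / n by positivity]
  refine sq_sum_sq_inner_le_of_bessel I (fun y : Fin M × Fin L => v y.1 y.2) h hB
    (fun y y' => |t y'.1 - t y.1| ≤ R) _ _ ?_ ?_
  · intro c
    set V : Fin M → H := fun i => ∑ l, c (i, l) • v i l with hV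
    set e : Fin M → ℝ := fun i => √(∑ l, ‖c (i, l)‖ ^ 2) with he
    have he2 : ∀ i, e i ^ 2 = ∑ l, ‖c (i, l)‖ ^ 2 := fun i => Real.sq_sqrt (by positivity)
    have he0 : ∀ i, 0 ≤ e i := fun i => Real.sqrt_nonneg _
    have hin : ∀ i k, (inner ℂ (V i) (V k) : ℂ) =
        ∑ l, ∑ l', inner ℂ (c (i, l) • v i l) (c (k, l') • v k l') := by
      intro i k
      simp only [hV, sum_inner, inner_sum]
      exact Finset.sum_comm
    have hVn : ∀ i, ‖V i‖ ≤ e i := by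
      intro i
      have h1 : ‖V i‖ ^ 2 ≤ e i ^ 2 := by
        have e1 : ‖V i‖ ^ 2 = ‖(inner ℂ (V i) (V i) : ℂ)‖ := by
          rw [inner_self_eq_norm_sq_to_K]; simp
        rw [e1, hin, he2, ← one_mul (∑ l, ‖c (i, l)‖ ^ 2)]
        refine le_trans ?_ (sum_mul_mul_le_of_symm
          (fun l l' => ‖(inner ℂ (v i l) (v i l') : ℂ)‖) (fun l => ‖c (i, l)‖) 1
          (fun _ _ => norm_nonneg _) (fun l l' => norm_inner_symm _ _) (hsame i))
        refine (norm_sum_le _ _).trans (Finset.sum_le_sum fun l _ => ?_)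
        refine (norm_sum_le _ _).trans (Finset.sum_le_sum fun l' _ => ?_)
        rw [inner_smul_left, inner_smul_right, norm_mul, norm_mul, RCLike.norm_conj]
        exact le_of_eq (by ring)
      exact (sq_le_sq₀ (norm_nonneg _) (he0 i)).1 h1
    have hsum : ∀ i, ∑ l, ‖c (i, l)‖ ≤ √L * e i := by
      intro i
      rw [he, ← Real.sqrt_mul (by positivity)]
      refine Real.le_sqrt_of_sq_le ?_
      have := sq_sum_le_card_mul_sum_sq (s := (Finset.univ : Finset (Fin L)))
        (f := fun l => ‖c (i, l)‖)
      simpa using this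
    have hVV : ∀ i k, ‖(inner ℂ (V i) (V k) : ℂ)‖ ≤
        (L : ℝ) ^ θ * (1 + |t k - t i|) ^ (κ - 1) * e i * e k := by
      intro i k
      set X : ℝ := 1 + |t k - t i| with hX
      have hX0 : 0 < X := by positivity
      have b1 : ‖(inner ℂ (V i) (V k) : ℂ)‖ ≤ e i * e k :=
        (norm_inner_le_norm _ _).trans
          (mul_le_mul (hVn i) (hVn k) (norm_nonneg _) (he0 i))
      have b2 : ‖(inner ℂ (V i) (V k) : ℂ)‖ ≤ (L * X ^ (-(n : ℝ) / 2)) * (e i * e k) := by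
        calc ‖(inner ℂ (V i) (V k) : ℂ)‖
            ≤ ∑ l, ∑ l', (‖c (i, l)‖ * ‖c (k, l')‖) * X ^ (-(n : ℝ) / 2) := by
              rw [hin]
              refine (norm_sum_le _ _).trans (Finset.sum_le_sum fun l _ => ?_)
              refine (norm_sum_le _ _).trans (Finset.sum_le_sum fun l' _ => ?_)
              rw [inner_smul_left, inner_smul_right, norm_mul, norm_mul, RCLike.norm_conj,
                ← mul_assoc]
              refine mul_le_mul_of_nonneg_left ?_ (by positivity)
              rw [hX, abs_sub_comm]
              exact hdisp i l k l'
          _ = (∑ l, ‖c (i, l)‖) * (∑ l, ‖c (k, l)‖) * X ^ (-(n : ℝ) / 2) := by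
              rw [Finset.sum_mul_sum, Finset.sum_mul]
              exact Finset.sum_congr rfl fun l _ => by rw [Finset.sum_mul]
          _ ≤ (√L * e i) * (√L * e k) * X ^ (-(n : ℝ) / 2) := by
              gcongr
              · exact hsum i
              · exact hsum k
          _ = _ := by
              have : √(L : ℝ) * √(L : ℝ) = L := Real.mul_self_sqrt (by positivity)
              linear_combination (e i * e k * X ^ (-(n : ℝ) / 2)) * this
      have hmin : min 1 (L * X ^ (-(n : ℝ) / 2)) ≤ (L : ℝ) ^ θ * X ^ (κ - 1) := by
        have e3 : (L : ℝ) ^ θ * X ^ (κ - 1) = (L * X ^ (-(n : ℝ) / 2)) ^ θ := by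
          rw [Real.mul_rpow (by positivity) (by positivity), ← Real.rpow_mul hX0.le]
          congr 2
          rw [hθ]; field_simp; ring
        rw [e3]
        set A : ℝ := L * X ^ (-(n : ℝ) / 2)
        have hA : 0 ≤ A := by positivity
        rcases le_total A 1 with h1 | h1
        · rw [min_eq_right h1]
          rcases hA.eq_or_lt with h0 | h0
          · rw [← h0]; exact Real.rpow_nonneg le_rfl _
          · simpa using Real.rpow_le_rpow_of_exponent_ge h0 h1 hθ1
        · rw [min_eq_left h1]
          exact Real.one_le_rpow h1 hθ0
      have h00 : 0 ≤ e i * e k := mul_nonneg (he0 i) (he0 k)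
      calc _ ≤ min 1 (L * X ^ (-(n : ℝ) / 2)) * (e i * e k) := by
            rcases min_choice 1 (L * X ^ (-(n : ℝ) / 2)) with h | h <;> rw [h]
            · rwa [one_mul]
            · exact b2
        _ ≤ _ := mul_le_mul_of_nonneg_right hmin h00
        _ = _ := by ring
    have e5 : ∑ y, ‖c y‖ ^ 2 = ∑ i, e i ^ 2 := by
      simp only [he2]
      rw [Fintype.sum_prod_type]
    have e6 : (∑ y : Fin M × Fin L, ∑ y' : Fin M × Fin L, if |t y'.1 - t y.1| ≤ R then
        (inner ℂ (c y • v y.1 y.2) (c y' • v y'.1 y'.2) : ℂ) else 0) =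
        ∑ i, ∑ k, if |t k - t i| ≤ R then inner ℂ (V i) (V k) else 0 := by
      simp only [hin, Fintype.sum_prod_type]
      refine Finset.sum_congr rfl fun i _ => ?_
      rw [Finset.sum_comm]
      refine Finset.sum_congr rfl fun k _ => ?_
      split_ifs <;> simp
    rw [e5, e6]
    refine le_trans ?_ (sum_mul_mul_le_of_symm
      (fun i k => if |t k - t i| ≤ R then (L : ℝ) ^ θ * (1 + |t k - t i|) ^ (κ - 1) else 0) e
      ((L : ℝ) ^ θ * (4 / κ * R ^ κ)) ?_ ?_ ?_)
    · refine (norm_sum_le _ _).trans (Finset.sum_le_sum fun i _ => ?_)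
      refine (norm_sum_le _ _).trans (Finset.sum_le_sum fun k _ => ?_)
      split_ifs
      · exact hVV i k
      · simp
    · intro i k
      split_ifs <;> positivity
    · intro i k
      simp only [abs_sub_comm (t k) (t i)]
    · intro i
      rw [← Finset.sum_filter, ← Finset.mul_sum]
      exact mul_le_mul_of_nonneg_left (sum_near_rpow_le _ t (t i) hsep hκ0 hκ1 hR)
        (by positivity)
  · simp only [Fintype.sum_prod_type]
    calc _ ≤ ∑ i : Fin M, ∑ l : Fin L, ∑ k : Fin M, ∑ l' : Fin L,
          (if |t k - t i| ≤ R then 0 else (1 + |t k - t i|) ^ (-(n : ℝ))) := by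
          refine Finset.sum_le_sum fun i _ => Finset.sum_le_sum fun l _ =>
            Finset.sum_le_sum fun k _ => Finset.sum_le_sum fun l' _ => ?_
          split_ifs
          · exact le_rfl
          · calc _ ≤ ((1 + |t i - t k|) ^ (-(n : ℝ) / 2)) ^ 2 := by
                  gcongr
                  exact hdisp i l k l'
              _ = _ := by
                  rw [← Real.rpow_natCast, ← Real.rpow_mul (by positivity), abs_sub_comm]
                  congr 1
                  push_cast; ring
      _ = ∑ i : Fin M, (L : ℝ) ^ 2 * ∑ k with ¬ |t k - t i| ≤ R,
          (1 + |t k - t i|) ^ (-(n : ℝ)) := by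
          refine Finset.sum_congr rfl fun i _ => ?_
          simp only [Finset.sum_const, Finset.card_univ, Fintype.card_fin, nsmul_eq_mul]
          rw [← Finset.mul_sum, Finset.sum_filter]
          simp only [ite_not]
          ring
      _ ≤ ∑ i : Fin M, (L : ℝ) ^ 2 * (4 * R ^ (1 - (n : ℝ))) := by
          refine Finset.sum_le_sum fun i _ => ?_
          exact mul_le_mul_of_nonneg_left (sum_far_rpow_le _ t (t i) hsep hn hR) (by positivity)
      _ = _ := by simp

theorem card_mul_rpow_le_of_dispersive {H : Type*} [NormedAddCommGroup H]
    [InnerProductSpace ℂ H] {n : ℕ} (hn : 2 ≤ n) {a b : ℝ} (ha : 0 ≤ a) (hb0 : 0 < b)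
    (hb1 : b < 1) (h1 : n * a ≤ (n - 1) * b) (h2 : 2 * b + n * a ≤ n) :
    ∃ C : ℝ, 0 < C ∧ ∀ (M L : ℕ), 1 ≤ L → ∀ (t : Fin M → ℝ)
      (_ : ∀ i k, i ≠ k → 1 ≤ |t i - t k|) (v : Fin M → Fin L → H)
      (_ : ∀ i l k l', ‖(inner ℂ (v i l) (v k l') : ℂ)‖ ≤ (1 + |t i - t k|) ^ (-(n : ℝ) / 2))
      (_ : ∀ i l, ∑ l', ‖(inner ℂ (v i l) (v i l') : ℂ)‖ ≤ 1)
      (I : Finset ℕ) (h : ℕ → H)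
      (_ : ∀ x, ∑ j ∈ I, ‖inner ℂ (h j) x‖ ^ 2 ≤ ‖x‖ ^ 2) (m : ℝ) (_ : 0 < m)
      (_ : m * (M * L) ≤ ∑ j ∈ I, ∑ y : Fin M × Fin L, ‖(inner ℂ (v y.1 y.2) (h j) : ℂ)‖ ^ 2),
      M * m ^ (1 / b) * L ^ (a / b) ≤ C * I.card := by
  have hn0 : (2 : ℝ) ≤ n := by exact_mod_cast hn
  set b1 : ℝ := max b (n / (n + 1)) with hb1d
  have hb1lt : b1 < 1 := max_lt hb1 (by rw [div_lt_one (by positivity)]; linarith)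
  have hb1ge : (n : ℝ) / (n + 1) ≤ b1 := le_max_right _ _
  have hbb1 : b ≤ b1 := le_max_left _ _
  have hb1pos : 0 < b1 := hb0.trans_le hbb1
  set q : ℝ := 1 / b1 with hq
  set r : ℝ := a / b with hr
  have hq1 : 1 < q := by rw [hq, lt_div_iff₀ hb1pos]; linarith
  have hqn : n * q ≤ n + 1 := by
    rw [hq, mul_one_div, div_le_iff₀ hb1pos]
    rwa [div_le_iff₀ (by positivity), mul_comm] at hb1ge
  have hq2 : q < 2 := by nlinarith
  have hr0 : 0 ≤ r := by positivity
  have hrq : n * r ≤ n * q - 2 := by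
    rcases max_choice b ((n : ℝ) / (n + 1)) with hm | hm
    · have : b1 = b := hm
      rw [hr, hq, this, ← sub_nonneg]
      have : n * (1 / b) - 2 - n * (a / b) = (n - (2 * b + n * a)) / b := by field_simp; ring
      rw [this]
      exact div_nonneg (by linarith) hb0.le
    · have e : q = (n + 1) / n := by
        rw [hq, show b1 = n / (n + 1) from hm]; field_simp
      have : n * q - 2 = n - 1 := by rw [e]; field_simp; ring
      rw [this, hr, ← mul_div_assoc, div_le_iff₀ hb0]
      exact h1
  set κ : ℝ := (q - 1) * (n - 1) / (2 - q) with hκ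
  have hκ0 : 0 < κ := div_pos (mul_pos (by linarith) (by linarith)) (by linarith)
  have hκ1 : κ ≤ 1 := by rw [hκ, div_le_one (by linarith)]; nlinarith
  set θ : ℝ := 2 / n * (1 - κ) with hθ
  have hκe : κ / (n - 1) = (q - 1) / (2 - q) := by
    have : (n : ℝ) - 1 ≠ 0 := by linarith
    rw [hκ]; field_simp
  have hexp : θ - 1 + r * κ / (n - 1) ≤ -r := by
    have h2q : (2 - q) ≠ 0 := by linarith
    have hnn : (n : ℝ) ≠ 0 := by positivity
    have : -r - (θ - 1 + r * κ / (n - 1)) = ((n * q - 2) - n * r) / (n * (2 - q)) := by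
      rw [mul_div_assoc, hκe, hθ, hκ]; field_simp; ring
    have h3 : 0 ≤ ((n * q - 2) - n * r) / (n * (2 - q)) :=
      div_nonneg (by linarith) (mul_nonneg (by linarith) (by linarith))
    linarith
  refine ⟨16 / κ + 8, by positivity, ?_⟩
  intro M L hL t hsep v hdisp hsame I h hB m hm hS
  have hLr : (1 : ℝ) ≤ L := by exact_mod_cast hL
  have hL0 : (0 : ℝ) < L := by linarith
  rcases Nat.eq_zero_or_pos M with hM0 | hMpos
  · subst hM0; simp; positivity
  have hM : (0 : ℝ) < M := by exact_mod_cast hMpos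
  set S : ℝ := ∑ j ∈ I, ∑ y : Fin M × Fin L, ‖(inner ℂ (v y.1 y.2) (h j) : ℂ)‖ ^ 2 with hSd
  have hm1 : m ≤ 1 := by
    have : S ≤ M * L := by
      rw [hSd, Finset.sum_comm]
      calc _ ≤ ∑ y : Fin M × Fin L, (1 : ℝ) := by
            refine Finset.sum_le_sum fun y _ => ?_
            calc _ = ∑ j ∈ I, ‖inner ℂ (h j) (v y.1 y.2)‖ ^ 2 :=
                  Finset.sum_congr rfl fun j _ => by rw [norm_inner_symm]
              _ ≤ ‖v y.1 y.2‖ ^ 2 := hB _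
              _ = ‖(inner ℂ (v y.1 y.2) (v y.1 y.2) : ℂ)‖ := by
                  rw [inner_self_eq_norm_sq_to_K]; simp
              _ ≤ _ := (hdisp y.1 y.2 y.1 y.2).trans (by simp)
        _ = _ := by simp
    have h3 : m * (M * L) ≤ 1 * (M * L) := by linarith
    exact le_of_mul_le_mul_right h3 (by positivity)
  set R : ℝ := m ^ (-(2 - q) / (n - 1)) * (L : ℝ) ^ (r / (n - 1)) with hR
  have hn1 : (0 : ℝ) < n - 1 := by linarith
  have hR1 : 1 ≤ R := by
    refine one_le_mul_of_one_le_of_one_le ?_ (Real.one_le_rpow hLr (by positivity))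
    exact Real.one_le_rpow_of_pos_of_le_one_of_nonpos hm hm1
      (div_nonpos_of_nonpos_of_nonneg (by linarith) hn1.le)
  have key := sq_sum_sq_inner_le_of_dispersive hn hκ0 hκ1 hθ t hsep v hdisp hsame I h hB hR1
  rw [← hSd] at key
  set N : ℝ := (I.card : ℝ) with hN
  have hN0 : 0 ≤ N := by positivity
  have hS0 : 0 < S := lt_of_lt_of_le (by positivity) hS
  have main : M * m ^ q * L ^ r ≤ (16 / κ + 8) * N := by
    set P : ℝ := (L : ℝ) ^ θ * (4 / κ * R ^ κ) with hP
    set F : ℝ := M * (L ^ 2 * (4 * R ^ (1 - (n : ℝ)))) with hF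
    have hPn : 0 ≤ P := by positivity
    have hFn : 0 ≤ F := by positivity
    rcases le_total (2 * P * S) F with hc | hc
    · have h3 : (m * (M * L)) ^ 2 ≤ 2 * N * F := by
        calc _ ≤ S ^ 2 := by gcongr
          _ ≤ N * (2 * P * S + F) := key
          _ ≤ N * (F + F) := by gcongr
          _ = _ := by ring
      have eR : R ^ (1 - (n : ℝ)) = m ^ (2 - q) * (L : ℝ) ^ (-r) := by
        rw [hR, Real.mul_rpow (by positivity) (by positivity), ← Real.rpow_mul hm.le,
          ← Real.rpow_mul hL0.le]
        congr 2 <;> field_simp <;> ring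
      have h4 : M * m ^ q * L ^ r ≤ 8 * N := by
        have em : m ^ 2 = m ^ q * m ^ (2 - q) := by
          rw [← Real.rpow_add hm, ← Real.rpow_natCast]; congr 1; push_cast; ring
        have eL : (L : ℝ) ^ r * (L : ℝ) ^ (-r) = 1 := by
          rw [← Real.rpow_add hL0]; simp
        rw [hF, eR] at h3
        have hm2 : 0 < m ^ (2 - q) := by positivity
        have h5 : (M * m ^ q * L ^ r) * (M * L ^ 2 * m ^ (2 - q) * (L : ℝ) ^ (-r)) ≤
            (8 * N) * (M * L ^ 2 * m ^ (2 - q) * (L : ℝ) ^ (-r)) := by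
          calc _ = (m * (M * L)) ^ 2 := by
                calc _ = M ^ 2 * L ^ 2 * (m ^ q * m ^ (2 - q)) *
                    ((L : ℝ) ^ r * (L : ℝ) ^ (-r)) := by ring
                  _ = _ := by rw [← em, eL]; ring
            _ ≤ _ := h3
            _ = _ := by ring
        exact le_of_mul_le_mul_right h5 (by positivity)
      have : 0 ≤ 16 / κ * N := by positivity
      linarith
    · have h3 : m * (M * L) ≤ 4 * N * P := by
        have h6 : S * S ≤ (4 * N * P) * S := by
          calc _ = S ^ 2 := by ring
            _ ≤ N * (2 * P * S + F) := key
            _ ≤ N * (2 * P * S + 2 * P * S) := by gcongr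
            _ = _ := by ring
        exact hS.trans (le_of_mul_le_mul_right h6 hS0)
      have eR : R ^ κ = m ^ (1 - q) * (L : ℝ) ^ (r * κ / (n - 1)) := by
        rw [hR, Real.mul_rpow (by positivity) (by positivity), ← Real.rpow_mul hm.le,
          ← Real.rpow_mul hL0.le]
        congr 2
        · rw [div_mul_eq_mul_div, mul_div_assoc, hκe]
          have : (2 - q) ≠ 0 := by linarith
          field_simp; ring
        · field_simp
      have h4 : M * m ^ q * L ^ r ≤ 16 / κ * N := by
        have em : m = m ^ q * m ^ (1 - q) := by
          rw [← Real.rpow_add hm, add_sub_cancel, Real.rpow_one]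
        have eL : (L : ℝ) ^ θ * (L : ℝ) ^ (r * κ / (n - 1)) * (L : ℝ) ^ r ≤ L := by
          rw [← Real.rpow_add hL0, ← Real.rpow_add hL0]
          calc _ ≤ (L : ℝ) ^ (1 : ℝ) := Real.rpow_le_rpow_of_exponent_le hLr (by linarith)
            _ = _ := Real.rpow_one _
        rw [hP, eR] at h3
        have h5 : (M * m ^ q * L ^ r) * (L * m ^ (1 - q)) ≤
            (16 / κ * N) * (L * m ^ (1 - q)) := by
          calc _ = (m ^ q * m ^ (1 - q)) * (M * L) * L ^ r := by ring
            _ = m * (M * L) * L ^ r := by rw [← em]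
            _ ≤ 4 * N * ((L : ℝ) ^ θ * (4 / κ * (m ^ (1 - q) * (L : ℝ) ^ (r * κ / (n - 1))))) *
                L ^ r := by gcongr
            _ = 16 / κ * N * m ^ (1 - q) *
                ((L : ℝ) ^ θ * (L : ℝ) ^ (r * κ / (n - 1)) * (L : ℝ) ^ r) := by ring
            _ ≤ 16 / κ * N * m ^ (1 - q) * L := 
                mul_le_mul_of_nonneg_left eL (mul_nonneg (mul_nonneg (div_pos (by norm_num) hκ0).le hN0)
                  (Real.rpow_nonneg hm.le _))
            _ = _ := by ring
        exact le_of_mul_le_mul_right h5 (by positivity)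
      linarith
  refine le_trans ?_ main
  have : m ^ (1 / b) ≤ m ^ q :=
    Real.rpow_le_rpow_of_exponent_ge hm hm1 (by rw [hq]; gcongr)
  gcongr

theorem dotC_eq_inner {n : ℕ} (x ξ : Rn n) : dotC x ξ = ((inner ℝ x ξ : ℝ) : ℂ) := by
  simp [dotC, PiLp.inner_apply, mul_comm]

/-- The frequency profile of a Gaussian of width `√τ` transported to time `t` and place `x`. -/
def gaussFun {n : ℕ} (τ t : ℝ) (x ξ : Rn n) : ℂ :=
  Complex.exp (-(Complex.I * dotC x ξ) + Complex.I * t * (‖ξ‖ : ℂ) ^ 2 - τ * (‖ξ‖ : ℂ) ^ 2)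

theorem continuous_gaussFun {n : ℕ} (τ t : ℝ) (x : Rn n) : Continuous (gaussFun τ t x) := by
  unfold gaussFun
  simp only [dotC_eq_inner]
  fun_prop

theorem norm_gaussFun {n : ℕ} (τ t : ℝ) (x ξ : Rn n) :
    ‖gaussFun τ t x ξ‖ = rexp (-τ * ‖ξ‖ ^ 2) := by
  rw [gaussFun, Complex.norm_exp, dotC_eq_inner]
  congr 1
  simp [← Complex.ofReal_pow]

theorem integrable_rexp_neg_mul_sq_norm {n : ℕ} {b : ℝ} (hb : 0 < b) :
    Integrable fun ξ : Rn n => rexp (-b * ‖ξ‖ ^ 2) := by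
  have := (GaussianFourier.integrable_cexp_neg_mul_sq_norm_add (V := Rn n) (b := (b : ℂ))
    (by simpa using hb) 0 0).norm
  refine this.congr (Filter.Eventually.of_forall fun ξ => ?_)
  simp only [Complex.norm_exp]
  congr 1
  simp [← Complex.ofReal_pow]

theorem memLp_gaussFun {n : ℕ} {τ : ℝ} (hτ : 0 < τ) (t : ℝ) (x : Rn n) :
    MemLp (gaussFun τ t x) 2 volume := by
  rw [memLp_two_iff_integrable_sq_norm (continuous_gaussFun τ t x).aestronglyMeasurable]
  refine (integrable_rexp_neg_mul_sq_norm (n := n) (b := 2 * τ) (by positivity)).congr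
    (Filter.Eventually.of_forall fun ξ => ?_)
  simp only [norm_gaussFun, ← Real.exp_nat_mul]
  congr 1
  push_cast; ring

/-- The Gaussian profile as an element of `L²`. -/
def gaussLp {n : ℕ} {τ : ℝ} (hτ : 0 < τ) (t : ℝ) (x : Rn n) : Lp ℂ 2 (volume : Measure (Rn n)) :=
  (memLp_gaussFun hτ t x).toLp _

theorem inner_gaussLp {n : ℕ} {τ : ℝ} (hτ : 0 < τ) (t t' : ℝ) (x x' : Rn n) :
    (inner ℂ (gaussLp hτ t x) (gaussLp hτ t' x') : ℂ) =
      (π / (2 * τ - Complex.I * (t' - t))) ^ (n / 2 : ℂ) *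
        Complex.exp (Complex.I ^ 2 * ‖x - x'‖ ^ 2 / (4 * (2 * τ - Complex.I * (t' - t)))) := by
  have := GaussianFourier.integral_cexp_neg_mul_sq_norm_add (V := Rn n)
    (b := 2 * τ - Complex.I * (t' - t)) (by simpa using hτ) Complex.I (x - x')
  simp only [finrank_euclideanSpace, Fintype.card_fin] at this
  rw [← this, L2.inner_def]
  refine integral_congr_ae ?_
  filter_upwards [(memLp_gaussFun hτ t x).coeFn_toLp, (memLp_gaussFun hτ t' x').coeFn_toLp]
    with ξ h1 h2
  simp only [gaussLp]
  rw [h1, h2, RCLike.inner_apply, gaussFun, gaussFun, ← Complex.exp_conj, ← Complex.exp_add]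
  congr 1
  simp only [dotC_eq_inner, map_add, map_sub, map_neg, map_mul, map_pow, Complex.conj_I,
    Complex.conj_ofReal, inner_sub_left, Complex.ofReal_sub]
  ring

theorem norm_inner_gaussLp_le {n : ℕ} {τ : ℝ} (hτ : 0 < τ) (t t' : ℝ) (x x' : Rn n) :
    ‖(inner ℂ (gaussLp hτ t x) (gaussLp hτ t' x') : ℂ)‖ ≤
      (2 * π / τ) ^ ((n : ℝ) / 2) * (1 + |t / τ - t' / τ|) ^ (-(n : ℝ) / 2) := by
  set B : ℂ := 2 * τ - Complex.I * (t' - t) with hB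
  have hre : B.re = 2 * τ := by simp [hB]
  have him : B.im = t - t' := by simp [hB]
  have hB0 : B ≠ 0 := fun h => by rw [h] at hre; simp at hre; linarith
  have hbB : (τ + |t - t'|) / 2 ≤ ‖B‖ := by
    refine le_of_sq_le_sq ?_ (norm_nonneg _)
    rw [← Complex.normSq_eq_norm_sq, Complex.normSq_apply, hre, him]
    nlinarith [sq_nonneg (τ - |t - t'|), sq_abs (t - t'), mul_pos hτ hτ, sq_nonneg (t - t')]
  rw [inner_gaussLp, norm_mul, Complex.norm_exp,
    show (n / 2 : ℂ) = (((n : ℝ) / 2 : ℝ) : ℂ) by push_cast; rfl, Complex.norm_cpow_real]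
  have h1 : (Complex.I ^ 2 * (‖x - x'‖ : ℂ) ^ 2 / (4 * B)).re ≤ 0 := by
    have : Complex.I ^ 2 * (‖x - x'‖ : ℂ) ^ 2 / (4 * B) =
        ((-(‖x - x'‖ ^ 2 / 4) : ℝ) : ℂ) * B⁻¹ := by
      rw [Complex.I_sq]; push_cast; field_simp
    rw [this, Complex.re_ofReal_mul, Complex.inv_re, hre]
    have : 0 ≤ 2 * τ / Complex.normSq B := div_nonneg (by linarith) (Complex.normSq_nonneg _)
    nlinarith [sq_nonneg ‖x - x'‖]
  have h2 : ‖(π : ℂ) / B‖ ≤ (2 * π / τ) * (1 + |t / τ - t' / τ|)⁻¹ := by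
    have hBpos : 0 < ‖B‖ := norm_pos_iff.2 hB0
    have e : (1 + |t / τ - t' / τ|) = (τ + |t - t'|) / τ := by
      rw [← sub_div, abs_div, abs_of_pos hτ]; field_simp
    rw [norm_div, Complex.norm_real, Real.norm_of_nonneg Real.pi_pos.le, e]
    have h0 : 0 < τ + |t - t'| := by positivity
    calc π / ‖B‖ ≤ π / ((τ + |t - t'|) / 2) := by gcongr
      _ = _ := by field_simp
  calc _ ≤ ((2 * π / τ) * (1 + |t / τ - t' / τ|)⁻¹) ^ ((n : ℝ) / 2) * 1 := by
        gcongr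
        exact Real.exp_le_one_iff.2 h1
    _ = _ := by
        rw [mul_one, Real.mul_rpow (by positivity) (by positivity), Real.inv_rpow (by positivity),
          ← Real.rpow_neg (by positivity), neg_div]

theorem norm_inner_gaussLp_same {n : ℕ} {τ : ℝ} (hτ : 0 < τ) (t : ℝ) (x x' : Rn n) :
    ‖(inner ℂ (gaussLp hτ t x) (gaussLp hτ t x') : ℂ)‖ =
      (π / (2 * τ)) ^ ((n : ℝ) / 2) * rexp (-(‖x - x'‖ ^ 2 / (8 * τ))) := by
  rw [inner_gaussLp, norm_mul, Complex.norm_exp,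
    show (n / 2 : ℂ) = (((n : ℝ) / 2 : ℝ) : ℂ) by push_cast; rfl, Complex.norm_cpow_real]
  have e1 : (π : ℂ) / (2 * τ - Complex.I * (t - t)) = ((π / (2 * τ) : ℝ) : ℂ) := by
    push_cast; simp
  have e2 : Complex.I ^ 2 * (‖x - x'‖ : ℂ) ^ 2 / (4 * (2 * τ - Complex.I * (t - t))) =
      ((-(‖x - x'‖ ^ 2 / (8 * τ)) : ℝ) : ℂ) := by
    rw [Complex.I_sq]; push_cast; rw [sub_self, mul_zero, sub_zero]; ring
  rw [e1, e2, Complex.norm_real, Real.norm_of_nonneg (by positivity), Complex.ofReal_re]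

theorem exists_sum_rexp_le (n : ℕ) : ∃ A : ℝ, 0 < A ∧ ∀ (τ : ℝ), 0 < τ → ∀ (L : ℕ)
    (y : Fin L → Rn n), (∀ l l', l ≠ l' → √τ ≤ dist (y l) (y l')) → ∀ x : Rn n,
    ∑ l, rexp (-(‖x - y l‖ ^ 2 / (8 * τ))) ≤ A := by
  set ω : ℝ := volume.real (Metric.ball (0 : Rn n) 1) with hω
  have hω0 : 0 < ω := by
    rw [hω, measureReal_def]
    exact ENNReal.toReal_pos (Metric.measure_ball_pos _ _ one_pos).ne' measure_ball_lt_top.ne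
  refine ⟨rexp (1 / 32) * (16 * π) ^ ((n : ℝ) / 2) * 2 ^ n / ω, by positivity, ?_⟩
  intro τ hτ L y hsep x
  have hball : ∀ l, volume.real (Metric.ball (y l) (√τ / 2)) = (√τ / 2) ^ n * ω := by
    intro l
    rw [measureReal_def, Measure.addHaar_ball_of_pos _ _ (by positivity), ENNReal.toReal_mul,
      ENNReal.toReal_ofReal (by positivity)]
    simp [hω, measureReal_def]
  have hgauss : Integrable fun z : Rn n => rexp (-(1 / (16 * τ)) * ‖x - z‖ ^ 2) :=
    (integrable_rexp_neg_mul_sq_norm (n := n) (b := 1 / (16 * τ))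
      (by positivity)).comp_sub_left x
  have hval : ∫ z : Rn n, rexp (-(1 / (16 * τ)) * ‖x - z‖ ^ 2) = (16 * π * τ) ^ ((n : ℝ) / 2) := by
    rw [integral_sub_left_eq_self (fun z : Rn n => rexp (-(1 / (16 * τ)) * ‖z‖ ^ 2)) volume x,
      GaussianFourier.integral_rexp_neg_mul_sq_norm (by positivity)]
    simp only [finrank_euclideanSpace, Fintype.card_fin]
    congr 1; field_simp
  have hdisj : Pairwise (Function.onFun Disjoint fun l => Metric.ball (y l) (√τ / 2)) := by
    intro l l' hl
    exact Metric.ball_disjoint_ball (by linarith [hsep l l' hl])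
  have hlow : ∀ l, rexp (-(‖x - y l‖ ^ 2 / (8 * τ))) * ((√τ / 2) ^ n * ω) ≤
      rexp (1 / 32) * ∫ z in Metric.ball (y l) (√τ / 2), rexp (-(1 / (16 * τ)) * ‖x - z‖ ^ 2) := by
    intro l
    rw [← hball l, ← integral_const_mul, mul_comm, ← smul_eq_mul, ← setIntegral_const]
    refine setIntegral_mono_on ?_ (hgauss.const_mul _).integrableOn measurableSet_ball ?_
    · exact integrableOn_const measure_ball_lt_top.ne
    · intro z hz
      rw [← Real.exp_add, Real.exp_le_exp]
      rw [Metric.mem_ball, dist_eq_norm] at hz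
      have h1 : ‖x - z‖ ≤ ‖x - y l‖ + ‖z - y l‖ := by
        rw [norm_sub_rev z]
        calc ‖x - z‖ = ‖(x - y l) + (y l - z)‖ := by congr 1; abel
          _ ≤ _ := norm_add_le _ _
      have h2 : ‖z - y l‖ ^ 2 ≤ τ / 4 := by
        have : ‖z - y l‖ ^ 2 ≤ (√τ / 2) ^ 2 := by gcongr
        rw [div_pow, Real.sq_sqrt hτ.le] at this
        linarith
      have h3 : ‖x - z‖ ^ 2 ≤ 2 * ‖x - y l‖ ^ 2 + τ / 2 := by
        nlinarith [sq_nonneg (‖x - y l‖ - ‖z - y l‖), norm_nonneg (x - z)]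
      have : 1 / 32 + -(1 / (16 * τ)) * ‖x - z‖ ^ 2 - -(‖x - y l‖ ^ 2 / (8 * τ)) =
          (2 * ‖x - y l‖ ^ 2 + τ / 2 - ‖x - z‖ ^ 2) / (16 * τ) := by field_simp; ring
      have h4 : 0 ≤ (2 * ‖x - y l‖ ^ 2 + τ / 2 - ‖x - z‖ ^ 2) / (16 * τ) :=
        div_nonneg (by linarith) (by positivity)
      linarith
  have htot : (∑ l, rexp (-(‖x - y l‖ ^ 2 / (8 * τ)))) * ((√τ / 2) ^ n * ω) ≤
      rexp (1 / 32) * (16 * π * τ) ^ ((n : ℝ) / 2) := by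
    rw [Finset.sum_mul]
    refine (Finset.sum_le_sum fun l _ => hlow l).trans ?_
    rw [← Finset.mul_sum, ← hval]
    gcongr
    rw [← integral_iUnion_fintype (fun l => measurableSet_ball) hdisj
      (fun l => hgauss.integrableOn)]
    exact setIntegral_le_integral hgauss (Filter.Eventually.of_forall fun z => (Real.exp_pos _).le)
  have hs : (√τ) ^ n = τ ^ ((n : ℝ) / 2) := by
    rw [Real.sqrt_eq_rpow, ← Real.rpow_natCast, ← Real.rpow_mul hτ.le]; congr 1; ring
  rw [div_pow, hs, Real.mul_rpow (by positivity) hτ.le] at htot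
  have hτn : 0 < τ ^ ((n : ℝ) / 2) := by positivity
  rw [le_div_iff₀ hω0]
  set B := ∑ l, rexp (-(‖x - y l‖ ^ 2 / (8 * τ)))
  have : B * ω * (τ ^ ((n : ℝ) / 2) / 2 ^ n) ≤
      (rexp (1 / 32) * (16 * π) ^ ((n : ℝ) / 2) * 2 ^ n) * (τ ^ ((n : ℝ) / 2) / 2 ^ n) := by
    calc _ = B * (τ ^ ((n : ℝ) / 2) / 2 ^ n * ω) := by ring
      _ ≤ _ := htot
      _ = _ := by field_simp
  exact le_of_mul_le_mul_right this (by positivity)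

theorem card_mul_rpow_le_of_gaussian {n : ℕ} (hn : 2 ≤ n) {a b : ℝ} (ha : 0 ≤ a) (hb0 : 0 < b)
    (hb1 : b < 1) (h1 : n * a ≤ (n - 1) * b) (h2 : 2 * b + n * a ≤ n) :
    ∃ C : ℝ, 0 < C ∧ ∀ (τ : ℝ) (hτ : 0 < τ) (M L : ℕ), 1 ≤ L → ∀ (t : Fin M → ℝ)
      (_ : ∀ i k, i ≠ k → τ ≤ dist (t i) (t k)) (x : Fin M → Fin L → Rn n)
      (_ : ∀ i l l', l ≠ l' → √τ ≤ dist (x i l) (x i l'))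
      (I : Finset ℕ) (h : ℕ → Lp ℂ 2 (volume : Measure (Rn n)))
      (_ : ∀ x, ∑ j ∈ I, ‖inner ℂ (h j) x‖ ^ 2 ≤ ‖x‖ ^ 2) (m : ℝ) (_ : 0 < m)
      (_ : ∀ i l, m ≤ ∑ j ∈ I, ‖(inner ℂ (gaussLp hτ (t i) (x i l)) (h j) : ℂ)‖ ^ 2),
      M * (m * τ ^ ((n : ℝ) / 2)) ^ (1 / b) * L ^ (a / b) ≤ C * I.card := by
  obtain ⟨C, hC, key⟩ := card_mul_rpow_le_of_dispersive
    (H := Lp ℂ 2 (volume : Measure (Rn n))) hn ha hb0 hb1 h1 h2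
  obtain ⟨A, hA, hsum⟩ := exists_sum_rexp_le n
  set D : ℝ := (2 * π) ^ ((n : ℝ) / 2) + (π / 2) ^ ((n : ℝ) / 2) * A with hD
  have hD0 : 0 < D := by positivity
  refine ⟨C * D ^ (1 / b), by positivity, ?_⟩
  intro τ hτ M L hL t ht x hx I h hB m hm hlow
  have hτn : 0 < τ ^ ((n : ℝ) / 2) := by positivity
  set c : ℝ := √(τ ^ ((n : ℝ) / 2) / D) with hc
  have hc2 : c ^ 2 = τ ^ ((n : ℝ) / 2) / D := Real.sq_sqrt (by positivity)
  have hin : ∀ u w : Lp ℂ 2 (volume : Measure (Rn n)),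
      ‖(inner ℂ ((c : ℂ) • u) ((c : ℂ) • w) : ℂ)‖ = τ ^ ((n : ℝ) / 2) / D * ‖(inner ℂ u w : ℂ)‖ := by
    intro u w
    rw [inner_smul_left, inner_smul_right, norm_mul, norm_mul, ← hc2]
    simp only [RCLike.norm_conj, Complex.norm_real, Real.norm_eq_abs]
    rw [← sq_abs c]; ring
  have := key M L hL (fun i => t i / τ) ?_ (fun i l => (c : ℂ) • gaussLp hτ (t i) (x i l)) ?_ ?_
    I h hB (m * τ ^ ((n : ℝ) / 2) / D) (by positivity) ?_
  · rw [Real.div_rpow (by positivity) hD0.le] at this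
    have hDb : 0 < D ^ (1 / b) := by positivity
    calc _ = (M * ((m * τ ^ ((n : ℝ) / 2)) ^ (1 / b) / D ^ (1 / b)) * L ^ (a / b)) *
          D ^ (1 / b) := by field_simp
      _ ≤ (C * I.card) * D ^ (1 / b) := by gcongr
      _ = _ := by ring
  · intro i k hik
    have := ht i k hik
    rw [Real.dist_eq] at this
    rw [← sub_div, abs_div, abs_of_pos hτ, le_div_iff₀ hτ]
    linarith
  · intro i l k l'
    rw [hin]
    calc _ ≤ τ ^ ((n : ℝ) / 2) / D * ((2 * π / τ) ^ ((n : ℝ) / 2) *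
          (1 + |t i / τ - t k / τ|) ^ (-(n : ℝ) / 2)) := by
          gcongr
          exact norm_inner_gaussLp_le hτ _ _ _ _
      _ = ((2 * π) ^ ((n : ℝ) / 2) / D) * (1 + |t i / τ - t k / τ|) ^ (-(n : ℝ) / 2) := by
          rw [Real.div_rpow (by positivity) hτ.le]; field_simp
      _ ≤ 1 * (1 + |t i / τ - t k / τ|) ^ (-(n : ℝ) / 2) := by
          gcongr
          rw [div_le_one hD0]
          have : 0 ≤ (π / 2) ^ ((n : ℝ) / 2) * A := by positivity
          linarith
      _ = _ := one_mul _
  · intro i l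
    simp only [hin, norm_inner_gaussLp_same]
    rw [← Finset.mul_sum, ← Finset.mul_sum]
    calc _ ≤ τ ^ ((n : ℝ) / 2) / D * ((π / (2 * τ)) ^ ((n : ℝ) / 2) * A) := by
          gcongr
          exact hsum τ hτ L (x i) (hx i) (x i l)
      _ = (π / 2) ^ ((n : ℝ) / 2) * A / D := by
          rw [← div_div, Real.div_rpow (by positivity) hτ.le]; field_simp
      _ ≤ 1 := by
          rw [div_le_one hD0]
          have : 0 ≤ (2 * π) ^ ((n : ℝ) / 2) := by positivity
          linarith
  · rw [Finset.sum_comm]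
    calc _ = ∑ y : Fin M × Fin L, m * τ ^ ((n : ℝ) / 2) / D := by simp; ring
      _ ≤ _ := by
        refine Finset.sum_le_sum fun y _ => ?_
        have e : ∀ j, ‖(inner ℂ ((c : ℂ) • gaussLp hτ (t y.1) (x y.1 y.2)) (h j) : ℂ)‖ ^ 2 =
            τ ^ ((n : ℝ) / 2) / D * ‖(inner ℂ (gaussLp hτ (t y.1) (x y.1 y.2)) (h j) : ℂ)‖ ^ 2 := by
          intro j
          rw [inner_smul_left, norm_mul, mul_pow, ← hc2]
          simp
        simp only [e]
        rw [← Finset.mul_sum]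
        calc _ = τ ^ ((n : ℝ) / 2) / D * m := by ring
          _ ≤ _ := by
            gcongr
            exact hlow _ _

theorem exists_separated {X : Type*} [PseudoMetricSpace X] [MeasurableSpace X] (μ : Measure X)
    {r : ℝ} {β : ℝ≥0∞} (hβ : ∀ x, μ (Metric.ball x r) ≤ β) (E : Set X) :
    ∀ M : ℕ, M * β < μ E → ∃ p : Fin (M + 1) → X, (∀ i, p i ∈ E) ∧
      ∀ i k, i ≠ k → r ≤ dist (p i) (p k) := by
  intro M
  induction M with
  | zero =>
    intro h
    obtain ⟨x, hx⟩ := nonempty_of_measure_ne_zero (pos_of_gt h).ne'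
    exact ⟨fun _ => x, fun _ => hx, fun i k hik => absurd (Subsingleton.elim (α := Fin 1) i k) hik⟩
  | succ M ih =>
    intro h
    obtain ⟨p, hp, hsep⟩ := ih (lt_of_le_of_lt (by gcongr; simp) h)
    have hU : μ (⋃ i, Metric.ball (p i) r) ≤ ((M + 1 : ℕ) : ℝ≥0∞) * β := by
      calc _ ≤ ∑ i, μ (Metric.ball (p i) r) := measure_iUnion_fintype_le _ _
        _ ≤ ∑ _i : Fin (M + 1), β := Finset.sum_le_sum fun i _ => hβ _
        _ = _ := by simp
    obtain ⟨y, hyE, hyU⟩ : ∃ y ∈ E, y ∉ ⋃ i, Metric.ball (p i) r := by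
      by_contra hcon
      push Not at hcon
      exact absurd (lt_of_lt_of_le h ((measure_mono hcon).trans hU)) (lt_irrefl _)
    have hy : ∀ i, r ≤ dist y (p i) := by
      intro i
      by_contra hlt
      exact hyU (mem_iUnion.2 ⟨i, Metric.mem_ball.2 (not_le.1 hlt)⟩)
    refine ⟨Fin.cons y p, fun i => Fin.cases hyE hp i, fun i k => ?_⟩
    refine Fin.cases ?_ (fun i => ?_) i <;> refine Fin.cases ?_ (fun k => ?_) k
    · simp
    · intro _; simpa using hy k
    · intro _; simpa [dist_comm] using hy i
    · intro hik
      simpa using hsep i k (fun h => hik (by rw [h]))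

/-- The closed region of exponents for which the single-scale estimate is available. -/
def Admissible (n : ℕ) (a b : ℝ) : Prop :=
  0 ≤ a ∧ 0 < b ∧ b < 1 ∧ n * a ≤ (n - 1) * b ∧ 2 * b + n * a ≤ n

/-- The total mass at `(t, x)` of a finite system, tested against Gaussians of width `√τ`. -/
def gaussMass {n : ℕ} {τ : ℝ} (hτ : 0 < τ) (I : Finset ℕ)
    (h : ℕ → Lp ℂ 2 (volume : Measure (Rn n))) (t : ℝ) (x : Rn n) : ℝ :=
  ∑ j ∈ I, ‖(inner ℂ (gaussLp hτ t x) (h j) : ℂ)‖ ^ 2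

/-- Bessel's inequality with constant one. -/
def IsBessel {H : Type*} [NormedAddCommGroup H] [InnerProductSpace ℂ H] (h : ℕ → H) : Prop :=
  ∀ (I : Finset ℕ) (x : H), ∑ j ∈ I, ‖(inner ℂ (h j) x : ℂ)‖ ^ 2 ≤ ‖x‖ ^ 2

theorem volume_le_of_separated {n : ℕ} (hn : 2 ≤ n) {a b : ℝ} (hab : Admissible n a b) :
    ∃ C : ℝ, 0 < C ∧ ∀ (τ : ℝ) (hτ : 0 < τ) (L : ℕ), 1 ≤ L → ∀ (I : Finset ℕ)
      (h : ℕ → Lp ℂ 2 (volume : Measure (Rn n))), IsBessel h → ∀ m : ℝ, 0 < m → ∀ E : Set ℝ,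
      (∀ t ∈ E, ∃ x : Fin L → Rn n, (∀ l l', l ≠ l' → √τ ≤ dist (x l) (x l')) ∧
        ∀ l, m ≤ gaussMass hτ I h t (x l)) →
      volume E ≤ ENNReal.ofReal
        (C * I.card * τ * (m * τ ^ ((n : ℝ) / 2)) ^ (-(1 / b)) * (L : ℝ) ^ (-(a / b))) := by
  obtain ⟨C, hC, key⟩ := card_mul_rpow_le_of_gaussian hn hab.1 hab.2.1 hab.2.2.1 hab.2.2.2.1
    hab.2.2.2.2
  refine ⟨2 * C, by positivity, ?_⟩
  intro τ hτ L hL I h hB m hm E hE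
  have hL0 : (0 : ℝ) < L := by exact_mod_cast hL
  set Q : ℝ := (m * τ ^ ((n : ℝ) / 2)) ^ (1 / b) * (L : ℝ) ^ (a / b) with hQ
  have hQ0 : 0 < Q := by positivity
  set X : ℝ := C * I.card / Q with hX
  have hX0 : 0 ≤ X := by positivity
  have e : 2 * C * I.card * τ * (m * τ ^ ((n : ℝ) / 2)) ^ (-(1 / b)) * (L : ℝ) ^ (-(a / b)) =
      X * (2 * τ) := by
    rw [hX, hQ, Real.rpow_neg (by positivity), Real.rpow_neg hL0.le]
    field_simp
  rw [e]
  by_contra hcon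
  push Not at hcon
  obtain ⟨p, hp, hsep⟩ := exists_separated volume (r := τ) (β := ENNReal.ofReal (2 * τ))
    (fun x => (Real.volume_ball x τ).le) E ⌊X⌋₊ (by
      refine lt_of_le_of_lt ?_ hcon
      rw [ENNReal.ofReal_mul hX0]
      gcongr
      rw [← ENNReal.ofReal_natCast]
      exact ENNReal.ofReal_le_ofReal (Nat.floor_le hX0))
  choose x hx using fun i => hE (p i) (hp i)
  have h1 := key τ hτ (⌊X⌋₊ + 1) L hL p hsep x (fun i => (hx i).1) I h (hB I) m hm
    (fun i l => (hx i).2 l)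
  have h2 : ((⌊X⌋₊ + 1 : ℕ) : ℝ) ≤ X := by
    rw [hX, le_div_iff₀ hQ0, hQ, ← mul_assoc]
    exact h1
  have := Nat.lt_floor_add_one X
  push_cast at h2
  linarith

theorem volume_exists_le {n : ℕ} (hn : 2 ≤ n) {b : ℝ} (hab : Admissible n 0 b) :
    ∃ C : ℝ, 0 < C ∧ ∀ (τ : ℝ) (hτ : 0 < τ) (I : Finset ℕ)
      (h : ℕ → Lp ℂ 2 (volume : Measure (Rn n))), IsBessel h → ∀ m : ℝ, 0 < m →
      volume {t | ∃ x, m ≤ gaussMass hτ I h t x} ≤ ENNReal.ofReal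
        (C * I.card * τ * (m * τ ^ ((n : ℝ) / 2)) ^ (-(1 / b))) := by
  obtain ⟨C, hC, key⟩ := volume_le_of_separated hn hab
  refine ⟨C, hC, fun τ hτ I h hB m hm => ?_⟩
  refine (key τ hτ 1 le_rfl I h hB m hm _ ?_).trans (by simp)
  rintro t ⟨x, hx⟩
  exact ⟨fun _ => x, fun l l' hl => absurd (Subsingleton.elim l l') hl, fun _ => hx⟩

theorem volume_volume_le {n : ℕ} (hn : 2 ≤ n) {a b : ℝ} (hab : Admissible n a b) :
    ∃ C : ℝ, 0 < C ∧ ∀ (τ : ℝ) (hτ : 0 < τ) (I : Finset ℕ)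
      (h : ℕ → Lp ℂ 2 (volume : Measure (Rn n))), IsBessel h → ∀ m : ℝ, 0 < m →
      ∀ κ : ℝ, 0 < κ →
      volume {t | ENNReal.ofReal κ < volume {x | m ≤ gaussMass hτ I h t x}} ≤ ENNReal.ofReal
        (C * I.card * τ * (m * τ ^ ((n : ℝ) / 2)) ^ (-(1 / b)) *
          (κ / τ ^ ((n : ℝ) / 2)) ^ (-(a / b))) := by
  obtain ⟨C, hC, key⟩ := volume_le_of_separated hn hab
  set ω : ℝ := volume.real (Metric.ball (0 : Rn n) 1) with hω
  have hω0 : 0 < ω := by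
    rw [hω, measureReal_def]
    exact ENNReal.toReal_pos (Metric.measure_ball_pos _ _ one_pos).ne' measure_ball_lt_top.ne
  refine ⟨C * ω ^ (a / b), by positivity, fun τ hτ I h hB m hm κ hκ => ?_⟩
  have hτn : 0 < τ ^ ((n : ℝ) / 2) := by positivity
  set Y : ℝ := κ / (τ ^ ((n : ℝ) / 2) * ω) with hY
  have hY0 : 0 < Y := by positivity
  have hball : ∀ y : Rn n, volume (Metric.ball y √τ) = ENNReal.ofReal (τ ^ ((n : ℝ) / 2) * ω) := by
    intro y
    rw [Measure.addHaar_ball_of_pos _ _ (by positivity), ENNReal.ofReal_mul hτn.le, hω,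
      ofReal_measureReal measure_ball_lt_top.ne]
    congr 2
    simp only [finrank_euclideanSpace, Fintype.card_fin]
    rw [Real.sqrt_eq_rpow, ← Real.rpow_natCast, ← Real.rpow_mul hτ.le]; congr 1; ring
  refine (key τ hτ (⌊Y⌋₊ + 1) (by omega) I h hB m hm _ ?_).trans ?_
  · intro t ht
    obtain ⟨p, hp, hsep⟩ := exists_separated volume (r := √τ) (fun x => (hball x).le)
      {x | m ≤ gaussMass hτ I h t x} ⌊Y⌋₊ (by
        refine lt_of_le_of_lt ?_ ht
        rw [← ENNReal.ofReal_natCast, ← ENNReal.ofReal_mul (by positivity)]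
        refine ENNReal.ofReal_le_ofReal ?_
        calc _ ≤ Y * (τ ^ ((n : ℝ) / 2) * ω) := by
              gcongr
              exact Nat.floor_le hY0.le
          _ = κ := by rw [hY]; field_simp)
    exact ⟨p, hsep, hp⟩
  · refine ENNReal.ofReal_le_ofReal ?_
    have hle : ((⌊Y⌋₊ + 1 : ℕ) : ℝ) ^ (-(a / b)) ≤
        ω ^ (a / b) * (κ / τ ^ ((n : ℝ) / 2)) ^ (-(a / b)) := by
      have hab0 : 0 ≤ a / b := div_nonneg hab.1 hab.2.1.le
      calc _ ≤ Y ^ (-(a / b)) := by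
            refine Real.rpow_le_rpow_of_nonpos hY0 ?_ (by linarith)
            push_cast
            exact (Nat.lt_floor_add_one Y).le
        _ = _ := by
            rw [hY, ← div_div, Real.div_rpow (by positivity) hω0.le, Real.rpow_neg hω0.le,
              div_inv_eq_mul, mul_comm]
    calc _ ≤ C * I.card * τ * (m * τ ^ ((n : ℝ) / 2)) ^ (-(1 / b)) *
          (ω ^ (a / b) * (κ / τ ^ ((n : ℝ) / 2)) ^ (-(a / b))) := by gcongr
      _ = _ := by ring

theorem integrable_cexp_mul_iff {n : ℕ} {φ : Rn n → ℝ} (hφ : Continuous φ) (f : Rn n → ℂ) :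
    Integrable (fun x => Complex.exp (Complex.I * φ x) * f x) ↔ Integrable f := by
  have h1 : ∀ x, ‖Complex.exp (Complex.I * φ x)‖ = 1 := fun x => by
    rw [mul_comm]; exact Complex.norm_exp_ofReal_mul_I _
  have hbdd : ∀ (ψ : Rn n → ℝ) (_ : Continuous ψ) (g : Rn n → ℂ), Integrable g →
      Integrable (fun x => Complex.exp (Complex.I * ψ x) * g x) := by
    intro ψ hψ g hg
    refine hg.bdd_mul (c := 1) (by fun_prop) (Filter.Eventually.of_forall fun x => ?_)
    rw [mul_comm]; exact (Complex.norm_exp_ofReal_mul_I _).le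
  refine ⟨fun h => ?_, hbdd φ hφ f⟩
  refine (hbdd (fun x => - φ x) hφ.neg _ h).congr (Filter.Eventually.of_forall fun x => ?_)
  simp only [← mul_assoc, ← Complex.exp_add]
  simp

theorem continuous_FT {n : ℕ} (f : Rn n → ℂ) : Continuous (FT f) := by
  unfold FT
  by_cases hf : Integrable f
  · refine continuous_of_dominated (bound := fun x => ‖f x‖) ?_ ?_ hf.norm ?_
    · intro ξ
      refine AEStronglyMeasurable.mul (Continuous.aestronglyMeasurable ?_) hf.1
      simp only [dotC_eq_inner]; fun_prop
    · intro ξ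
      refine Filter.Eventually.of_forall fun x => ?_
      rw [norm_mul, dotC_eq_inner, ← mul_neg, mul_comm Complex.I, ← Complex.ofReal_neg,
        Complex.norm_exp_ofReal_mul_I, one_mul]
    · refine Filter.Eventually.of_forall fun x => ?_
      simp only [dotC_eq_inner]; fun_prop
  · have : (fun ξ => ∫ x : Rn n, Complex.exp (-(Complex.I * dotC x ξ)) * f x) = fun _ => 0 := by
      funext ξ
      refine integral_undef fun h => hf ?_
      refine (integrable_cexp_mul_iff (φ := fun x => -(inner ℝ x ξ)) (by fun_prop) f).1
        (h.congr (Filter.Eventually.of_forall fun x => ?_))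
      simp only [dotC_eq_inner]
      push_cast; rw [mul_neg]
    rw [this]
    exact continuous_const

theorem schrodinger_apply {n : ℕ} (f : Rn n → ℂ) (t : ℝ) (x : Rn n) :
    schrodinger f t x = ((2 * π : ℝ) ^ (-(n : ℝ)) : ℝ) •
      ∫ ξ : Rn n, Complex.exp (Complex.I * ((inner ℝ x ξ - t * ‖ξ‖ ^ 2 : ℝ) : ℂ)) * FT f ξ := by
  simp [schrodinger, prop, dotC_eq_inner]

theorem schrodinger_eq_zero {n : ℕ} {f : Rn n → ℂ} (hf : ¬ Integrable (FT f)) (t : ℝ) (x : Rn n) :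
    schrodinger f t x = 0 := by
  rw [schrodinger_apply, integral_undef, smul_zero]
  rwa [integrable_cexp_mul_iff (φ := fun ξ => inner ℝ x ξ - t * ‖ξ‖ ^ 2) (by fun_prop)]

theorem continuous_schrodinger {n : ℕ} (f : Rn n → ℂ) :
    Continuous fun z : ℝ × Rn n => schrodinger f z.1 z.2 := by
  by_cases hf : Integrable (FT f)
  · simp only [schrodinger_apply]
    refine Continuous.const_smul (M := ℝ) (α := ℂ) ?_ _
    refine continuous_of_dominated (bound := fun x => ‖FT f x‖) ?_ ?_ hf.norm ?_
    · intro z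
      exact AEStronglyMeasurable.mul (Continuous.aestronglyMeasurable (by fun_prop)) hf.1
    · intro z
      refine Filter.Eventually.of_forall fun x => ?_
      rw [norm_mul, mul_comm Complex.I, Complex.norm_exp_ofReal_mul_I, one_mul]
    · exact Filter.Eventually.of_forall fun x => by fun_prop
  · simp only [schrodinger_eq_zero hf]
    exact continuous_const

theorem exists_orthonormal_of_orthonormalHs {n : ℕ} {s : ℝ} {f : ℕ → Rn n → ℂ}
    (hf : OrthonormalHs s f) : ∃ g : ℕ → Lp ℂ 2 (volume : Measure (Rn n)), Orthonormal ℂ g ∧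
      ∀ j, g j =ᵐ[volume] fun ξ =>
        (((2 * π) ^ (-(n : ℝ) / 2) * ‖ξ‖ ^ s : ℝ) : ℂ) * FT (f j) ξ := by
  set G : ℕ → Rn n → ℂ := fun j ξ => (((2 * π) ^ (-(n : ℝ) / 2) * ‖ξ‖ ^ s : ℝ) : ℂ) * FT (f j) ξ
    with hG
  have hmeas : ∀ j, AEStronglyMeasurable (G j) volume := by
    intro j
    refine AEStronglyMeasurable.mul (Measurable.aestronglyMeasurable ?_)
      (continuous_FT (f j)).aestronglyMeasurable
    fun_prop
  have hc : ((2 * π : ℝ) ^ (-(n : ℝ) / 2)) ^ 2 = (2 * π : ℝ) ^ (-(n : ℝ)) := by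
    rw [← Real.rpow_natCast, ← Real.rpow_mul (by positivity)]; congr 1; push_cast; ring
  have hs2 : ∀ ξ : Rn n, ‖ξ‖ ^ (2 * s) = (‖ξ‖ ^ s) ^ 2 := by
    intro ξ
    rw [← Real.rpow_natCast, ← Real.rpow_mul (norm_nonneg _)]; congr 1; push_cast; ring
  have hprod : ∀ j k ξ, (starRingEnd ℂ) (G j ξ) * G k ξ = ((2 * π : ℝ) ^ (-(n : ℝ)) : ℝ) •
      (((‖ξ‖ ^ (2 * s) : ℝ) : ℂ) * (FT (f k) ξ * (starRingEnd ℂ) (FT (f j) ξ))) := by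
    intro j k ξ
    simp only [hG, map_mul, Complex.conj_ofReal, ← hc, hs2, Complex.real_smul]
    push_cast; ring
  have hL2 : ∀ j, MemLp (G j) 2 volume := by
    intro j
    rw [memLp_two_iff_integrable_sq_norm (hmeas j)]
    have h1 : Integrable fun ξ : Rn n => (starRingEnd ℂ) (G j ξ) * G j ξ := by
      by_contra hcon
      have := integral_undef hcon
      simp only [hprod, integral_smul, hf j j] at this
      simp at this
    refine h1.norm.congr (Filter.Eventually.of_forall fun ξ => ?_)
    simp [sq]
  refine ⟨fun j => (hL2 j).toLp _, ?_, fun j => (hL2 j).coeFn_toLp⟩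
  rw [orthonormal_iff_ite]
  intro j k
  rw [L2.inner_def]
  have : ∀ᵐ ξ ∂(volume : Measure (Rn n)), (inner ℂ (((hL2 j).toLp _ : Lp ℂ 2 volume) ξ)
      (((hL2 k).toLp _ : Lp ℂ 2 volume) ξ) : ℂ) = (starRingEnd ℂ) (G j ξ) * G k ξ := by
    filter_upwards [(hL2 j).coeFn_toLp, (hL2 k).coeFn_toLp] with ξ h1 h2
    rw [h1, h2, RCLike.inner_apply, mul_comm]
  rw [integral_congr_ae this]
  simp only [hprod, integral_smul, hf k j, eq_comm]

/-- Multiplication of an `L²` function by a measurable function bounded by one. -/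
theorem exists_mul_bessel {n : ℕ} {g : ℕ → Lp ℂ 2 (volume : Measure (Rn n))}
    (hg : Orthonormal ℂ g) {θ : Rn n → ℝ} (hθm : Measurable θ) (hθ : ∀ ξ, |θ ξ| ≤ 1) :
    ∃ h : ℕ → Lp ℂ 2 (volume : Measure (Rn n)), IsBessel h ∧
      ∀ j, h j =ᵐ[volume] fun ξ => (θ ξ : ℂ) * g j ξ := by
  have hmem : ∀ u : Lp ℂ 2 (volume : Measure (Rn n)),
      MemLp (fun ξ => (θ ξ : ℂ) * u ξ) 2 volume := by
    intro u
    refine (Lp.memLp u).of_le (AEStronglyMeasurable.mul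
      (Measurable.aestronglyMeasurable (by fun_prop)) (Lp.aestronglyMeasurable u))
      (Filter.Eventually.of_forall fun ξ => ?_)
    rw [norm_mul, Complex.norm_real]
    exact mul_le_of_le_one_left (norm_nonneg _) (hθ ξ)
  refine ⟨fun j => (hmem (g j)).toLp _, fun I x => ?_, fun j => (hmem (g j)).coeFn_toLp⟩
  have e : ∀ j, (inner ℂ ((hmem (g j)).toLp _) x : ℂ) = inner ℂ (g j) ((hmem x).toLp _) := by
    intro j
    rw [L2.inner_def, L2.inner_def]
    refine integral_congr_ae ?_
    filter_upwards [(hmem (g j)).coeFn_toLp, (hmem x).coeFn_toLp] with ξ h1 h2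
    rw [h1, h2, RCLike.inner_apply, RCLike.inner_apply, map_mul, Complex.conj_ofReal]
    ring
  simp only [e]
  refine (hg.sum_inner_products_le _).trans ?_
  gcongr
  rw [Lp.norm_toLp, Lp.norm_def]
  refine ENNReal.toReal_mono (Lp.eLpNorm_ne_top x) (eLpNorm_mono fun ξ => ?_)
  rw [norm_mul, Complex.norm_real]
  exact mul_le_of_le_one_left (norm_nonneg _) (hθ ξ)

theorem existsUnique_shell {τ₀ y : ℝ} (hτ : 0 < τ₀) (hy : 0 < y) :
    ∃! k : ℤ, τ₀ * 2 ^ k * y ∈ Ico (1 : ℝ) 2 := by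
  have h2 : ∀ k : ℤ, (0 : ℝ) < 2 ^ k := fun k => by positivity
  obtain ⟨k, hk⟩ := exists_mem_Ico_zpow (x := τ₀ * y) (y := (2 : ℝ)) (by positivity) (by norm_num)
  have key : ∀ m : ℤ, τ₀ * 2 ^ (-m) * y = τ₀ * y / 2 ^ m := by
    intro m; rw [zpow_neg]; field_simp
  refine ⟨-k, ?_, ?_⟩
  · simp only [key]
    constructor
    · rw [le_div_iff₀ (h2 k), one_mul]; exact hk.1
    · rw [div_lt_iff₀ (h2 k)]
      have := hk.2
      rw [zpow_add₀ (by norm_num)] at this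
      simpa [mul_comm] using this
  · intro m hm
    obtain ⟨l, rfl⟩ : ∃ l, m = -l := ⟨-m, by simp⟩
    simp only [key] at hm
    rw [neg_inj]
    have h3 : (2 : ℝ) ^ l ≤ τ₀ * y := by
      have := hm.1; rwa [le_div_iff₀ (h2 l), one_mul] at this
    have h4 : τ₀ * y < 2 ^ (l + 1) := by
      have := hm.2
      rw [div_lt_iff₀ (h2 l)] at this
      rw [zpow_add₀ (by norm_num)]; simpa [mul_comm] using this
    have a1 : l < k + 1 := (zpow_lt_zpow_iff_right₀ (by norm_num : (1 : ℝ) < 2)).1 (h3.trans_lt hk.2)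
    have a2 : k < l + 1 := (zpow_lt_zpow_iff_right₀ (by norm_num : (1 : ℝ) < 2)).1 (hk.1.trans_lt h4)
    omega

/-- The constant in the decomposition of the free evolution into Gaussian coefficients. -/
def gaussConst (n : ℕ) : ℝ := (2 * π) ^ (-(n : ℝ) / 2) * rexp 2

theorem gaussConst_pos (n : ℕ) : 0 < gaussConst n := by
  unfold gaussConst; positivity

theorem scale_pos {τ₀ : ℝ} (hτ : 0 < τ₀) (k : ℤ) : 0 < τ₀ * 2 ^ k := by positivity

theorem exists_gauss_decomposition {n : ℕ} (hn : 2 ≤ n) {s : ℝ} (hs : 0 ≤ s)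
    {f : ℕ → Rn n → ℂ} (hf : OrthonormalHs s f) {τ₀ : ℝ} (hτ : 0 < τ₀) :
    ∃ h : ℤ → ℕ → Lp ℂ 2 (volume : Measure (Rn n)), (∀ k, IsBessel (h k)) ∧
      ∀ j, Integrable (FT (f j)) → ∀ t x, HasSum (fun k : ℤ =>
        ((gaussConst n * (τ₀ * 2 ^ k) ^ (s / 2) : ℝ) : ℂ) *
          inner ℂ (gaussLp (scale_pos hτ k) t x) (h k j)) (schrodinger (f j) t x) := by
  have : Nontrivial (Rn n) := by
    have : Nonempty (Fin n) := ⟨⟨0, by omega⟩⟩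
    infer_instance
  obtain ⟨g, hg, hgF⟩ := exists_orthonormal_of_orthonormalHs hf
  set A : ℤ → Set (Rn n) := fun k => {ξ | τ₀ * 2 ^ k * ‖ξ‖ ^ 2 ∈ Ico (1 : ℝ) 2} with hA
  have hAm : ∀ k, MeasurableSet (A k) := fun k =>
    measurableSet_Ico.preimage (by fun_prop : Measurable fun ξ : Rn n => τ₀ * 2 ^ k * ‖ξ‖ ^ 2)
  have hAd : Pairwise (Function.onFun Disjoint A) := by
    intro k l hkl
    refine Set.disjoint_left.2 fun ξ h1 h2 => hkl ?_
    have h0 : 0 < ‖ξ‖ ^ 2 := by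
      rcases (sq_nonneg ‖ξ‖).eq_or_lt with h | h
      · have : (1 : ℝ) ≤ τ₀ * 2 ^ k * ‖ξ‖ ^ 2 := h1.1
        rw [← h] at this; norm_num at this
      · exact h
    exact (existsUnique_shell hτ h0).unique h1 h2
  have hAu : (⋃ k, A k) =ᵐ[volume] (univ : Set (Rn n)) := by
    rw [ae_eq_univ]
    refine measure_mono_null (t := {0}) (fun ξ hξ => ?_) (measure_singleton 0)
    by_contra h0
    have h1 : 0 < ‖ξ‖ ^ 2 := by
      have : 0 < ‖ξ‖ := norm_pos_iff.2 h0
      positivity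
    obtain ⟨k, hk, -⟩ := existsUnique_shell hτ h1
    exact hξ (mem_iUnion.2 ⟨k, hk⟩)
  set θ : ℤ → Rn n → ℝ := fun k => (A k).indicator fun ξ =>
    rexp (-2) * (√(τ₀ * 2 ^ k) * ‖ξ‖) ^ (-s) * rexp (τ₀ * 2 ^ k * ‖ξ‖ ^ 2) with hθ
  have hθm : ∀ k, Measurable (θ k) := fun k => Measurable.indicator (by fun_prop) (hAm k)
  have hθ1 : ∀ k ξ, |θ k ξ| ≤ 1 := by
    intro k ξ
    simp only [hθ]
    by_cases hξ : ξ ∈ A k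
    · rw [indicator_of_mem hξ, abs_of_nonneg (by positivity)]
      have h1 : τ₀ * 2 ^ k * ‖ξ‖ ^ 2 ∈ Ico (1 : ℝ) 2 := hξ
      have h2 : 1 ≤ √(τ₀ * 2 ^ k) * ‖ξ‖ := by
        rw [← Real.sqrt_sq (norm_nonneg ξ), ← Real.sqrt_mul (scale_pos hτ k).le]
        exact Real.one_le_sqrt.2 h1.1
      calc _ ≤ rexp (-2) * 1 * rexp 2 := by
            gcongr
            · exact Real.rpow_le_one_of_one_le_of_nonpos h2 (by linarith)
            · exact h1.2.le
        _ = 1 := by rw [mul_one, ← Real.exp_add]; simp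
    · rw [indicator_of_notMem hξ]; simp
  choose h hB hh using fun k => exists_mul_bessel hg (hθm k) (hθ1 k)
  refine ⟨h, hB, fun j hj t x => ?_⟩
  set W : Rn n → ℂ := fun ξ =>
    Complex.exp (Complex.I * ((inner ℝ x ξ - t * ‖ξ‖ ^ 2 : ℝ) : ℂ)) * FT (f j) ξ with hW
  have hWi : Integrable W :=
    (integrable_cexp_mul_iff (φ := fun ξ => inner ℝ x ξ - t * ‖ξ‖ ^ 2) (by fun_prop) _).2 hj
  have hsum := hasSum_integral_iUnion hAm hAd (f := W) (μ := volume) hWi.integrableOn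
  rw [setIntegral_congr_set hAu, setIntegral_univ] at hsum
  have hsum2 := hsum.const_smul (((2 * π : ℝ) ^ (-(n : ℝ)) : ℝ))
  rw [schrodinger_apply]
  refine hsum2.congr_fun fun k => ?_
  set τ : ℝ := τ₀ * 2 ^ k with hτk
  have hτ0 : 0 < τ := scale_pos hτ k
  set c : ℝ := rexp (-2) * (2 * π) ^ (-(n : ℝ) / 2) * τ ^ (-(s / 2)) with hc
  have hin : (inner ℂ (gaussLp hτ0 t x) (h k j) : ℂ) = ∫ ξ, (A k).indicator (fun ξ => (c : ℂ) * W ξ) ξ := by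
    rw [L2.inner_def]
    refine integral_congr_ae ?_
    filter_upwards [(memLp_gaussFun hτ0 t x).coeFn_toLp, hh k j, hgF j] with ξ e1 e2 e3
    rw [gaussLp, e1, e2, e3, RCLike.inner_apply]
    by_cases hξ : ξ ∈ A k
    · rw [indicator_of_mem hξ]
      have hξ0 : 0 < ‖ξ‖ := by
        rcases (norm_nonneg ξ).eq_or_lt with h0 | h0
        · have : (1 : ℝ) ≤ τ₀ * 2 ^ k * ‖ξ‖ ^ 2 := hξ.1
          rw [← h0] at this; norm_num at this
        · exact h0
      have hreal : θ k ξ * ((2 * π) ^ (-(n : ℝ) / 2) * ‖ξ‖ ^ s) * rexp (-τ * ‖ξ‖ ^ 2) = c := by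
        simp only [hθ]
        rw [indicator_of_mem hξ, Real.mul_rpow (Real.sqrt_nonneg _) hξ0.le, Real.sqrt_eq_rpow,
          ← Real.rpow_mul hτ0.le, hc, show 1 / 2 * -s = -(s / 2) by ring]
        have a1 : ‖ξ‖ ^ (-s) * ‖ξ‖ ^ s = 1 := by rw [← Real.rpow_add hξ0]; simp
        have a2 : rexp (τ * ‖ξ‖ ^ 2) * rexp (-τ * ‖ξ‖ ^ 2) = 1 := by
          rw [← Real.exp_add]; simp
        calc _ = rexp (-2) * (2 * π) ^ (-(n : ℝ) / 2) * τ ^ (-(s / 2)) *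
              (‖ξ‖ ^ (-s) * ‖ξ‖ ^ s) * (rexp (τ * ‖ξ‖ ^ 2) * rexp (-τ * ‖ξ‖ ^ 2)) := by ring
          _ = _ := by rw [a1, a2]; ring
      have hexp : (starRingEnd ℂ) (gaussFun τ t x ξ) =
          Complex.exp (Complex.I * ((inner ℝ x ξ - t * ‖ξ‖ ^ 2 : ℝ) : ℂ)) *
            ((rexp (-τ * ‖ξ‖ ^ 2) : ℝ) : ℂ) := by
        rw [gaussFun, ← Complex.exp_conj, Complex.ofReal_exp, ← Complex.exp_add]
        congr 1
        simp only [dotC_eq_inner, map_add, map_sub, map_neg, map_mul, map_pow, Complex.conj_I,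
          Complex.conj_ofReal]
        push_cast; ring
      rw [hexp, ← hreal]
      simp only [hW]
      push_cast; ring
    · rw [indicator_of_notMem hξ]
      simp [hθ, indicator_of_notMem hξ]
  rw [hin, integral_indicator (hAm k), integral_const_mul, ← mul_assoc, Complex.real_smul,
    ← Complex.ofReal_mul]
  congr 2
  rw [hc, gaussConst]
  have a1 : τ ^ (s / 2) * τ ^ (-(s / 2)) = 1 := by rw [← Real.rpow_add hτ0]; simp
  have a2 : rexp 2 * rexp (-2) = 1 := by rw [← Real.exp_add]; simp
  have a3 : (2 * π : ℝ) ^ (-(n : ℝ) / 2) * (2 * π : ℝ) ^ (-(n : ℝ) / 2) =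
      (2 * π : ℝ) ^ (-(n : ℝ)) := by
    rw [← Real.rpow_add (by positivity)]; congr 1; ring
  calc _ = ((2 * π : ℝ) ^ (-(n : ℝ) / 2) * (2 * π : ℝ) ^ (-(n : ℝ) / 2)) *
        (τ ^ (s / 2) * τ ^ (-(s / 2))) * (rexp 2 * rexp (-2)) := by ring
    _ = _ := by rw [a1, a2, a3]; ring

/-- The density of a finite subfamily. -/
def finDensity {n : ℕ} (f : ℕ → Rn n → ℂ) (J : Finset ℕ) (t : ℝ) (x : Rn n) : ℝ :=
  ∑ j ∈ J, ‖schrodinger (f j) t x‖ ^ 2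

theorem finDensity_nonneg {n : ℕ} (f : ℕ → Rn n → ℂ) (J : Finset ℕ) (t : ℝ) (x : Rn n) :
    0 ≤ finDensity f J t x := Finset.sum_nonneg fun _ _ => by positivity

theorem continuous_finDensity {n : ℕ} (f : ℕ → Rn n → ℂ) (J : Finset ℕ) :
    Continuous fun z : ℝ × Rn n => finDensity f J z.1 z.2 := by
  unfold finDensity
  exact continuous_finsetSum _ fun j _ => (continuous_schrodinger (f j)).norm.pow 2

theorem gaussMass_mono {n : ℕ} {τ : ℝ} (hτ : 0 < τ) {I J : Finset ℕ} (hIJ : I ⊆ J)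
    (h : ℕ → Lp ℂ 2 (volume : Measure (Rn n))) (t : ℝ) (x : Rn n) :
    gaussMass hτ I h t x ≤ gaussMass hτ J h t x :=
  Finset.sum_le_sum_of_subset_of_nonneg hIJ fun _ _ _ => by positivity

theorem exists_scale_of_lt_finDensity {n : ℕ} (hn : 2 ≤ n) {s : ℝ} (hs : 0 ≤ s)
    {f : ℕ → Rn n → ℂ} (hf : OrthonormalHs s f) {τ₀ : ℝ} (hτ : 0 < τ₀) {d : ℤ → ℝ}
    (hd0 : ∀ k, 0 ≤ d k) (hd : HasSum d 1) :
    ∃ h : ℤ → ℕ → Lp ℂ 2 (volume : Measure (Rn n)), (∀ k, IsBessel (h k)) ∧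
      ∀ (J : Finset ℕ) (m : ℝ) (t : ℝ) (x : Rn n), 0 < m → m < finDensity f J t x →
        ∃ k, d k ^ 2 * (τ₀ * 2 ^ k) ^ (-s) * m / gaussConst n ^ 2 ≤
          gaussMass (scale_pos hτ k) J (h k) t x := by
  classical
  obtain ⟨h, hB, hsum⟩ := exists_gauss_decomposition hn hs hf hτ
  refine ⟨h, hB, fun J m t x hm hlt => ?_⟩
  set I : Finset ℕ := J.filter fun j => Integrable (FT (f j)) with hI
  have hDI : finDensity f J t x = ∑ j : I, ‖schrodinger (f j) t x‖ ^ 2 := by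
    rw [Finset.sum_coe_sort I fun j => ‖schrodinger (f j) t x‖ ^ 2, hI, Finset.sum_filter]
    refine Finset.sum_congr rfl fun j _ => ?_
    split_ifs with hj
    · rfl
    · rw [schrodinger_eq_zero hj]; simp
  by_contra hcon
  push Not at hcon
  set U : ℤ → EuclideanSpace ℂ I := fun k => WithLp.toLp 2 fun j : I =>
    ((gaussConst n * (τ₀ * 2 ^ k) ^ (s / 2) : ℝ) : ℂ) *
      inner ℂ (gaussLp (scale_pos hτ k) t x) (h k j) with hU
  set u : EuclideanSpace ℂ I := WithLp.toLp 2 fun j : I => schrodinger (f j) t x with hu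
  have hUsum : HasSum U u := by
    have : HasSum (fun k => (U k).ofLp) u.ofLp :=
      Pi.hasSum.2 fun j => hsum j (Finset.mem_filter.1 j.2).2 t x
    exact this.mapL (EuclideanSpace.equiv I ℂ).symm.toContinuousLinearMap
  have hUb : ∀ k, ‖U k‖ ≤ d k * √m := by
    intro k
    set τ : ℝ := τ₀ * 2 ^ k with hτk
    have hτ0 : 0 < τ := scale_pos hτ k
    have hgc := gaussConst_pos n
    rw [EuclideanSpace.norm_eq]
    refine Real.sqrt_le_iff.2 ⟨mul_nonneg (hd0 k) (Real.sqrt_nonneg _), ?_⟩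
    rw [mul_pow, Real.sq_sqrt hm.le]
    have e1 : ∑ j : I, ‖(U k).ofLp j‖ ^ 2 =
        gaussConst n ^ 2 * τ ^ s * gaussMass hτ0 I (h k) t x := by
      rw [gaussMass, Finset.mul_sum,
        ← Finset.sum_coe_sort I fun j => gaussConst n ^ 2 * τ ^ s *
          ‖(inner ℂ (gaussLp hτ0 t x) (h k j) : ℂ)‖ ^ 2]
      refine Finset.sum_congr rfl fun j _ => ?_
      have : (τ ^ (s / 2)) ^ 2 = τ ^ s := by
        rw [← Real.rpow_natCast, ← Real.rpow_mul hτ0.le]; congr 1; push_cast; ring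
      simp only [hU]
      rw [norm_mul, mul_pow, Complex.norm_real, Real.norm_of_nonneg (by positivity), mul_pow, this]
    rw [e1]
    have h2 := (gaussMass_mono hτ0 (Finset.filter_subset _ J : I ⊆ J) (h k) t x).trans (hcon k).le
    calc _ ≤ gaussConst n ^ 2 * τ ^ s * (d k ^ 2 * τ ^ (-s) * m / gaussConst n ^ 2) := by gcongr
      _ = d k ^ 2 * m * (τ ^ s * τ ^ (-s)) := by field_simp
      _ = _ := by rw [← Real.rpow_add hτ0]; simp
  have hle : ‖u‖ ≤ √m := by
    have := tsum_of_norm_bounded (hd.mul_right √m) hUb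
    rwa [hUsum.tsum_eq, one_mul] at this
  have : ‖u‖ ^ 2 ≤ m := by
    calc _ ≤ √m ^ 2 := by gcongr
      _ = m := Real.sq_sqrt hm.le
  rw [EuclideanSpace.norm_eq, Real.sq_sqrt (by positivity)] at this
  rw [hDI] at hlt
  exact absurd hlt (not_lt.2 this)

/-- The two-sided geometric weight `2^{-η|k|}`. -/
def geo (η : ℝ) (k : ℤ) : ℝ := (2 : ℝ) ^ (-(η * |(k : ℝ)|))

theorem geo_pos (η : ℝ) (k : ℤ) : 0 < geo η k := by unfold geo; positivity

theorem summable_geo {η : ℝ} (hη : 0 < η) : Summable (geo η) := by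
  have h1 : Summable fun k : ℕ => ((2 : ℝ) ^ (-η)) ^ k :=
    summable_geometric_of_lt_one (by positivity)
      (Real.rpow_lt_one_of_one_lt_of_neg (by norm_num) (by linarith))
  have h2 : ∀ k : ℕ, ((2 : ℝ) ^ (-η)) ^ k = geo η k := by
    intro k
    rw [geo, ← Real.rpow_natCast, ← Real.rpow_mul (zero_le_two : (0 : ℝ) ≤ 2)]
    congr 1
    simp
  have h3 : ∀ k : ℕ, ((2 : ℝ) ^ (-η)) ^ k = geo η (-k) := by
    intro k
    rw [h2]; simp [geo]
  exact Summable.of_nat_of_neg (h1.congr h2) (h1.congr h3)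

theorem two_zpow_eq_rpow (k : ℤ) : (2 : ℝ) ^ k = (2 : ℝ) ^ (k : ℝ) := (Real.rpow_intCast 2 k).symm

theorem exists_volume_exists_le_geo {n : ℕ} (hn : 2 ≤ n) {b b' s η c : ℝ} (hb : 0 < b)
    (hab : Admissible n 0 b') (hs : 2 * s = n - 2 * b) (hη : 0 < η) (hc : 0 < c) :
    ∃ K : ℝ, 0 < K ∧ ∀ (σ : ℝ) (_ : 0 < σ) (k : ℤ),
      k * (b' - b) ≤ -(4 * η * |(k : ℝ)|) → ∀ (hτ : 0 < σ ^ (-(1 / b)) * 2 ^ k)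
      (J : Finset ℕ) (h : ℕ → Lp ℂ 2 (volume : Measure (Rn n))), IsBessel h →
      volume {t | ∃ x, (c * geo η k) ^ 2 * (σ ^ (-(1 / b)) * 2 ^ k) ^ (-s) * σ / gaussConst n ^ 2 ≤
        gaussMass hτ J h t x} ≤ ENNReal.ofReal (K * J.card * σ ^ (-(1 / b)) * geo η k) := by
  obtain ⟨C, hC, key⟩ := volume_exists_le hn hab
  have hG := gaussConst_pos n
  have hb'0 : 0 < b' := hab.2.1
  refine ⟨C * (c ^ 2 / gaussConst n ^ 2) ^ (-(1 / b')), by positivity, ?_⟩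
  intro σ hσ k hk hτ J h hB
  refine (key _ hτ J h hB _ (by have := geo_pos η k; positivity)).trans ?_
  refine ENNReal.ofReal_le_ofReal ?_
  set τ₀ : ℝ := σ ^ (-(1 / b)) with hτ₀
  have hτ₀0 : 0 < τ₀ := by positivity
  have hτb : τ₀ ^ b * σ = 1 := by
    rw [hτ₀, ← Real.rpow_mul hσ.le]
    nth_rewrite 2 [← Real.rpow_one σ]
    rw [← Real.rpow_add hσ, show -(1 / b) * b + 1 = 0 by field_simp; ring, Real.rpow_zero]
  have e1 : (c * geo η k) ^ 2 * (τ₀ * 2 ^ k) ^ (-s) * σ / gaussConst n ^ 2 *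
      (τ₀ * 2 ^ k) ^ ((n : ℝ) / 2) =
      (c ^ 2 / gaussConst n ^ 2) * (2 : ℝ) ^ (k * b - 2 * η * |(k : ℝ)|) := by
    have a1 : (τ₀ * 2 ^ k) ^ (-s) * (τ₀ * 2 ^ k) ^ ((n : ℝ) / 2) = τ₀ ^ b * (2 : ℝ) ^ (k * b) := by
      rw [← Real.rpow_add hτ, show -s + (n : ℝ) / 2 = b by linarith,
        Real.mul_rpow hτ₀0.le (by positivity), two_zpow_eq_rpow, ← Real.rpow_mul (zero_le_two : (0 : ℝ) ≤ 2)]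
    have a2 : geo η k ^ 2 * (2 : ℝ) ^ (k * b) = (2 : ℝ) ^ (k * b - 2 * η * |(k : ℝ)|) := by
      rw [geo, ← Real.rpow_natCast, ← Real.rpow_mul (zero_le_two : (0 : ℝ) ≤ 2), ← Real.rpow_add (by norm_num)]
      congr 1; push_cast; ring
    calc _ = (c ^ 2 / gaussConst n ^ 2) * geo η k ^ 2 * σ *
          ((τ₀ * 2 ^ k) ^ (-s) * (τ₀ * 2 ^ k) ^ ((n : ℝ) / 2)) := by ring
      _ = (c ^ 2 / gaussConst n ^ 2) * (geo η k ^ 2 * (2 : ℝ) ^ (k * b)) * (τ₀ ^ b * σ) := by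
          rw [a1]; ring
      _ = _ := by rw [a2, hτb, mul_one]
  rw [e1, Real.mul_rpow (by positivity) (by positivity), ← Real.rpow_mul (zero_le_two : (0 : ℝ) ≤ 2)]
  have e2 : (2 : ℝ) ^ k * (2 : ℝ) ^ ((k * b - 2 * η * |(k : ℝ)|) * -(1 / b')) ≤ geo η k := by
    rw [two_zpow_eq_rpow, ← Real.rpow_add (by norm_num), geo]
    refine Real.rpow_le_rpow_of_exponent_le (by norm_num) ?_
    have : (k : ℝ) + (k * b - 2 * η * |(k : ℝ)|) * -(1 / b') =
        (k * (b' - b) + 2 * η * |(k : ℝ)|) / b' := by field_simp; ring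
    rw [this, div_le_iff₀ hb'0]
    have h5 : 0 ≤ η * |(k : ℝ)| := by positivity
    nlinarith [hab.2.2.1]
  calc _ = C * J.card * τ₀ * (c ^ 2 / gaussConst n ^ 2) ^ (-(1 / b')) *
        ((2 : ℝ) ^ k * (2 : ℝ) ^ ((k * b - 2 * η * |(k : ℝ)|) * -(1 / b'))) := by ring
    _ ≤ C * J.card * τ₀ * (c ^ 2 / gaussConst n ^ 2) ^ (-(1 / b')) * geo η k := by gcongr
    _ = _ := by ring

theorem exists_volume_volume_le_geo {n : ℕ} (hn : 2 ≤ n) {a b a' b' s η c : ℝ} (hb : 0 < b)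
    (hab : Admissible n a' b') (hs : 2 * s = n - (2 * b + n * a)) (hη : 0 < η) (hc : 0 < c) :
    ∃ K : ℝ, 0 < K ∧ ∀ (σ : ℝ) (_ : 0 < σ) (k l : ℤ),
      k * (b' - b) + (a' - a) * (l + k * (n / 2)) ≤ -(6 * η * (|(k : ℝ)| + |(l : ℝ)|)) →
      ∀ (hτ : 0 < σ ^ (-(1 / b)) * 2 ^ k)
      (J : Finset ℕ) (h : ℕ → Lp ℂ 2 (volume : Measure (Rn n))), IsBessel h →
      volume {t | ENNReal.ofReal ((c * geo η l) * (c * geo η k) / 2 *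
          (σ ^ (-(1 / b))) ^ ((n : ℝ) / 2) * 2 ^ (-l)) <
        volume {x | (c * geo η k) ^ 2 * (σ ^ (-(1 / b)) * 2 ^ k) ^ (-s) *
          (σ * (σ ^ (-(1 / b))) ^ (-(n * a / 2)) * 2 ^ (l * a)) / gaussConst n ^ 2 ≤
        gaussMass hτ J h t x}} ≤
      ENNReal.ofReal (K * J.card * σ ^ (-(1 / b)) * (geo η k * geo η l)) := by
  obtain ⟨C, hC, key⟩ := volume_volume_le hn hab
  have hG := gaussConst_pos n
  have hb'0 : 0 < b' := hab.2.1
  have ha'1 : a' ≤ 1 := by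
    have h1 : n * a' ≤ (n - 1) * b' := hab.2.2.2.1
    have hn' : (2 : ℝ) ≤ n := by exact_mod_cast hn
    nlinarith [hab.2.2.1]
  refine ⟨C * (c ^ 2 / gaussConst n ^ 2) ^ (-(1 / b')) * (c ^ 2 / 2) ^ (-(a' / b')),
    by positivity, ?_⟩
  intro σ hσ k l hkl hτ J h hB
  have g1 := geo_pos η k
  have g2 := geo_pos η l
  refine (key _ hτ J h hB _ (by positivity) _ (by positivity)).trans ?_
  refine ENNReal.ofReal_le_ofReal ?_
  set τ₀ : ℝ := σ ^ (-(1 / b)) with hτ₀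
  have hτ₀0 : 0 < τ₀ := by positivity
  have hτb : τ₀ ^ b * σ = 1 := by
    rw [hτ₀, ← Real.rpow_mul hσ.le]
    nth_rewrite 2 [← Real.rpow_one σ]
    rw [← Real.rpow_add hσ, show -(1 / b) * b + 1 = 0 by field_simp; ring, Real.rpow_zero]
  have e1 : (c * geo η k) ^ 2 * (τ₀ * 2 ^ k) ^ (-s) * (σ * τ₀ ^ (-(n * a / 2)) * 2 ^ (l * a)) /
      gaussConst n ^ 2 * (τ₀ * 2 ^ k) ^ ((n : ℝ) / 2) =
      (c ^ 2 / gaussConst n ^ 2) *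
        (2 : ℝ) ^ (l * a + k * (b + n * a / 2) - 2 * η * |(k : ℝ)|) := by
    have a1 : (τ₀ * 2 ^ k) ^ (-s) * (τ₀ * 2 ^ k) ^ ((n : ℝ) / 2) =
        τ₀ ^ b * τ₀ ^ (n * a / 2) * (2 : ℝ) ^ (k * (b + n * a / 2)) := by
      rw [← Real.rpow_add hτ, show -s + (n : ℝ) / 2 = b + n * a / 2 by linarith,
        Real.mul_rpow hτ₀0.le (by positivity), two_zpow_eq_rpow, ← Real.rpow_mul (zero_le_two : (0 : ℝ) ≤ 2),
        Real.rpow_add hτ₀0]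
    have a2 : geo η k ^ 2 * ((2 : ℝ) ^ (l * a) * (2 : ℝ) ^ (k * (b + n * a / 2))) =
        (2 : ℝ) ^ (l * a + k * (b + n * a / 2) - 2 * η * |(k : ℝ)|) := by
      rw [geo, ← Real.rpow_natCast, ← Real.rpow_mul (zero_le_two : (0 : ℝ) ≤ 2), ← Real.rpow_add (by norm_num),
        ← Real.rpow_add (by norm_num)]
      congr 1; push_cast; ring
    have a3 : τ₀ ^ (-(n * a / 2)) * τ₀ ^ (n * a / 2) = 1 := by
      rw [← Real.rpow_add hτ₀0]; simp
    calc _ = (c ^ 2 / gaussConst n ^ 2) * geo η k ^ 2 * σ * τ₀ ^ (-(n * a / 2)) * 2 ^ (l * a) *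
          ((τ₀ * 2 ^ k) ^ (-s) * (τ₀ * 2 ^ k) ^ ((n : ℝ) / 2)) := by ring
      _ = (c ^ 2 / gaussConst n ^ 2) *
          (geo η k ^ 2 * ((2 : ℝ) ^ (l * a) * (2 : ℝ) ^ (k * (b + n * a / 2)))) *
          (τ₀ ^ b * σ) * (τ₀ ^ (-(n * a / 2)) * τ₀ ^ (n * a / 2)) := by
          rw [a1]; ring
      _ = _ := by rw [a2, a3, hτb, mul_one, mul_one]
  have e2 : (c * geo η l) * (c * geo η k) / 2 * τ₀ ^ ((n : ℝ) / 2) * 2 ^ (-l) /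
      (τ₀ * 2 ^ k) ^ ((n : ℝ) / 2) =
      (c ^ 2 / 2) * (2 : ℝ) ^ (-(η * (|(k : ℝ)| + |(l : ℝ)|)) - (l + k * (n / 2))) := by
    have a1 : (τ₀ * 2 ^ k) ^ ((n : ℝ) / 2) = τ₀ ^ ((n : ℝ) / 2) * (2 : ℝ) ^ (k * ((n : ℝ) / 2)) := by
      rw [Real.mul_rpow hτ₀0.le (by positivity), two_zpow_eq_rpow, ← Real.rpow_mul (zero_le_two : (0 : ℝ) ≤ 2)]
    have a2 : (2 : ℝ) ^ (-(η * (|(k : ℝ)| + |(l : ℝ)|)) - (l + k * (n / 2))) =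
        geo η l * geo η k * (2 : ℝ) ^ (-(l : ℝ)) / (2 : ℝ) ^ (k * ((n : ℝ) / 2)) := by
      rw [geo, geo, ← Real.rpow_add (by norm_num), ← Real.rpow_add (by norm_num),
        ← Real.rpow_sub (by norm_num)]
      congr 1; ring
    rw [a1, a2, two_zpow_eq_rpow]
    push_cast
    field_simp
  rw [e1, e2, Real.mul_rpow (by positivity) (by positivity), ← Real.rpow_mul (zero_le_two : (0 : ℝ) ≤ 2),
    Real.mul_rpow (by positivity) (by positivity), ← Real.rpow_mul (zero_le_two : (0 : ℝ) ≤ 2)]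
  set X1 : ℝ := (l * a + k * (b + n * a / 2) - 2 * η * |(k : ℝ)|) * -(1 / b') with hX1
  set X2 : ℝ := (-(η * (|(k : ℝ)| + |(l : ℝ)|)) - (l + k * (n / 2))) * -(a' / b') with hX2
  have e3 : (2 : ℝ) ^ k * (2 : ℝ) ^ X1 * (2 : ℝ) ^ X2 ≤ geo η k * geo η l := by
    rw [two_zpow_eq_rpow, ← Real.rpow_add (by norm_num), ← Real.rpow_add (by norm_num), geo, geo,
      ← Real.rpow_add (by norm_num)]
    refine Real.rpow_le_rpow_of_exponent_le (by norm_num) ?_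
    have : (k : ℝ) + X1 + X2 = (k * (b' - b) + (a' - a) * (l + k * (n / 2)) + 2 * η * |(k : ℝ)| +
        a' * (η * (|(k : ℝ)| + |(l : ℝ)|))) / b' := by rw [hX1, hX2]; field_simp; ring
    rw [this, div_le_iff₀ hb'0]
    have h5 : 0 ≤ η * |(k : ℝ)| := by positivity
    have h6 : 0 ≤ η * |(l : ℝ)| := by positivity
    nlinarith [hab.2.2.1, mul_nonneg (sub_nonneg.2 ha'1) (add_nonneg h5 h6),
      mul_nonneg (sub_nonneg.2 hab.2.2.1.le) (add_nonneg h5 h6)]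
  calc _ = C * J.card * τ₀ * (c ^ 2 / gaussConst n ^ 2) ^ (-(1 / b')) *
        (c ^ 2 / 2) ^ (-(a' / b')) * ((2 : ℝ) ^ k * (2 : ℝ) ^ X1 * (2 : ℝ) ^ X2) := by ring
    _ ≤ C * J.card * τ₀ * (c ^ 2 / gaussConst n ^ 2) ^ (-(1 / b')) *
        (c ^ 2 / 2) ^ (-(a' / b')) * (geo η k * geo η l) := by gcongr
    _ = _ := by ring

theorem hasSum_geo_div {η : ℝ} (hη : 0 < η) :
    HasSum (fun k => (∑' i, geo η i)⁻¹ * geo η k) 1 := by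
  have hS : 0 < ∑' i, geo η i :=
    (summable_geo hη).tsum_pos (fun k => (geo_pos η k).le) 0 (geo_pos η 0)
  have := (summable_geo hη).hasSum.mul_left (∑' i, geo η i)⁻¹
  rwa [inv_mul_cancel₀ hS.ne'] at this

theorem toReal_expOf {a : ℝ} (ha : 0 < a) : (expOf a).toReal = 1 / a := by
  rw [expOf, ENNReal.toReal_inv, ENNReal.toReal_ofReal ha.le, one_div]

theorem expOf_ne_top {a : ℝ} (ha : 0 < a) : expOf a ≠ ∞ := by
  simp [expOf, ha]

theorem expOf_ne_zero (a : ℝ) : expOf a ≠ 0 := by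
  simp [expOf]

theorem volume_lt_eLpNorm_finDensity_top {n : ℕ} (hn : 2 ≤ n) {b s : ℝ} (hb : 0 < b) (hb1 : b < 1)
    (hs : 2 * s = n - 2 * b) :
    ∃ C : ℝ, 0 < C ∧ ∀ f : ℕ → Rn n → ℂ, OrthonormalHs s f → ∀ (J : Finset ℕ) (σ : ℝ), 0 < σ →
      volume {t | ENNReal.ofReal σ < eLpNorm (finDensity f J t) (expOf 0) volume} ≤
        ENNReal.ofReal (C * J.card * σ ^ (-(1 / b))) := by
  have hn' : (2 : ℝ) ≤ n := by exact_mod_cast hn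
  set δ : ℝ := min b (1 - b) / 2 with hδ
  have hδ0 : 0 < δ := by
    have : 0 < min b (1 - b) := lt_min hb (by linarith)
    positivity
  have hδ1 : 2 * δ ≤ b := by rw [hδ]; linarith [min_le_left b (1 - b)]
  have hδ2 : 2 * δ ≤ 1 - b := by rw [hδ]; linarith [min_le_right b (1 - b)]
  have adm : ∀ b', b - δ ≤ b' → b' ≤ b + δ → Admissible n 0 b' := by
    intro b' h1 h2
    refine ⟨le_rfl, by linarith, by linarith, ?_, by linarith⟩
    have : 0 < b' := by linarith
    nlinarith
  set η : ℝ := δ / 4 with hη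
  have hη0 : 0 < η := by positivity
  set S : ℝ := ∑' i, geo η i with hS
  have hS0 : 0 < S := (summable_geo hη0).tsum_pos (fun k => (geo_pos η k).le) 0 (geo_pos η 0)
  obtain ⟨K₁, hK₁, key₁⟩ := exists_volume_exists_le_geo hn hb
    (adm (b - δ) le_rfl (by linarith)) hs hη0 (inv_pos.2 hS0)
  obtain ⟨K₂, hK₂, key₂⟩ := exists_volume_exists_le_geo hn hb
    (adm (b + δ) (by linarith) le_rfl) hs hη0 (inv_pos.2 hS0)
  refine ⟨(K₁ + K₂) * S, by positivity, fun f hf J σ hσ => ?_⟩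
  have hτ : 0 < σ ^ (-(1 / b)) := by positivity
  obtain ⟨h, hB, hex⟩ := exists_scale_of_lt_finDensity hn (by linarith) hf hτ
    (fun k => by have := geo_pos η k; positivity) (hasSum_geo_div hη0)
  have hsub : {t | ENNReal.ofReal σ < eLpNorm (finDensity f J t) (expOf 0) volume} ⊆
      ⋃ k : ℤ, {t | ∃ x, (S⁻¹ * geo η k) ^ 2 * (σ ^ (-(1 / b)) * 2 ^ k) ^ (-s) * σ /
        gaussConst n ^ 2 ≤ gaussMass (scale_pos hτ k) J (h k) t x} := by
    intro t ht
    have : ∃ x, σ < finDensity f J t x := by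
      by_contra! hcon
      rw [Set.mem_ofPred_eq] at ht
      refine ht.not_ge ?_
      rw [show expOf 0 = ∞ by simp [expOf], eLpNorm_exponent_top]
      refine eLpNormEssSup_le_of_ae_bound (Filter.Eventually.of_forall fun x => ?_)
      rw [Real.norm_of_nonneg (finDensity_nonneg f J t x)]
      exact hcon x
    obtain ⟨x, hx⟩ := this
    obtain ⟨k, hk⟩ := hex J σ t x hσ hx
    exact mem_iUnion.2 ⟨k, x, hk⟩
  have hk : ∀ k : ℤ, volume {t | ∃ x, (S⁻¹ * geo η k) ^ 2 * (σ ^ (-(1 / b)) * 2 ^ k) ^ (-s) * σ /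
        gaussConst n ^ 2 ≤ gaussMass (scale_pos hτ k) J (h k) t x} ≤
      ENNReal.ofReal ((K₁ + K₂) * J.card * σ ^ (-(1 / b)) * geo η k) := by
    intro k
    have hg := geo_pos η k
    rcases le_total 0 k with h0 | h0
    · have h0' : (0 : ℝ) ≤ k := by exact_mod_cast h0
      refine (key₁ σ hσ k ?_ _ J (h k) (hB k)).trans (ENNReal.ofReal_le_ofReal ?_)
      · rw [abs_of_nonneg h0', hη]; linarith
      · gcongr; linarith
    · have h0' : (k : ℝ) ≤ 0 := by exact_mod_cast h0
      refine (key₂ σ hσ k ?_ _ J (h k) (hB k)).trans (ENNReal.ofReal_le_ofReal ?_)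
      · rw [abs_of_nonpos h0', hη]; linarith
      · gcongr; linarith
  refine (measure_mono hsub).trans ((measure_iUnion_le _).trans ((ENNReal.tsum_le_tsum hk).trans ?_))
  rw [← ENNReal.ofReal_tsum_of_nonneg (fun k => by have := geo_pos η k; positivity)
    ((summable_geo hη0).mul_left _), tsum_mul_left]
  exact ENNReal.ofReal_le_ofReal (by rw [← hS]; exact le_of_eq (by ring))

theorem lintegral_rpow_le_tsum {X : Type*} [MeasurableSpace X] {μ : Measure X} {g : X → ℝ}
    (hg : Measurable g) {M a : ℝ} (hM : 0 < M) (ha : 0 < a) :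
    ∫⁻ x, ENNReal.ofReal (g x) ^ (1 / a) ∂μ ≤
      ∑' l : ℤ, ENNReal.ofReal (M ^ (1 / a) * 2 ^ (l + 1)) * μ {x | M * 2 ^ (l * a) < g x} := by
  have hms : ∀ l : ℤ, MeasurableSet {x | M * 2 ^ (l * a) < g x} := fun l =>
    measurableSet_lt measurable_const hg
  calc ∫⁻ x, ENNReal.ofReal (g x) ^ (1 / a) ∂μ
      ≤ ∫⁻ x, ∑' l : ℤ, {x | M * 2 ^ (l * a) < g x}.indicator
          (fun _ => ENNReal.ofReal (M ^ (1 / a) * 2 ^ (l + 1))) x ∂μ := by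
        refine lintegral_mono fun x => ?_
        rcases le_or_gt (g x) 0 with h0 | h0
        · simp only
          rw [ENNReal.ofReal_eq_zero.2 h0, ENNReal.zero_rpow_of_pos (by positivity)]
          exact zero_le
        obtain ⟨l, hl⟩ := exists_mem_Ioc_zpow (x := (g x / M) ^ (1 / a)) (y := (2 : ℝ))
          (by positivity) (by norm_num)
        have hgM : g x = M * ((g x / M) ^ (1 / a)) ^ a := by
          rw [← Real.rpow_mul (by positivity), one_div_mul_cancel ha.ne', Real.rpow_one]
          field_simp
        refine le_trans ?_ (ENNReal.le_tsum l)
        rw [indicator_of_mem]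
        · simp only
          rw [ENNReal.ofReal_rpow_of_pos h0]
          refine ENNReal.ofReal_le_ofReal ?_
          have : g x ^ (1 / a) = M ^ (1 / a) * (g x / M) ^ (1 / a) := by
            rw [← Real.mul_rpow hM.le (by positivity)]
            congr 1; field_simp
          rw [this]
          exact mul_le_mul_of_nonneg_left hl.2 (by positivity)
        · rw [Set.mem_ofPred_eq]
          have h2 : (2 : ℝ) ^ (l * a) < ((g x / M) ^ (1 / a)) ^ a := by
            rw [Real.rpow_mul zero_le_two, Real.rpow_intCast]
            exact Real.rpow_lt_rpow (by positivity) hl.1 ha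
          calc M * 2 ^ (l * a) < M * ((g x / M) ^ (1 / a)) ^ a := mul_lt_mul_of_pos_left h2 hM
            _ = g x := hgM.symm
    _ = _ := by
        rw [lintegral_tsum fun l => (measurable_const.indicator (hms l)).aemeasurable]
        exact tsum_congr fun l => lintegral_indicator_const (hms l) _

theorem volume_lt_eLpNorm_finDensity {n : ℕ} (hn : 2 ≤ n) {a b s : ℝ} (ha : 0 < a) (hb : 0 < b)
    (hb1 : b < 1) (h1 : n * a < (n - 1) * b) (h2 : 2 * b + n * a < n)
    (hs : 2 * s = n - (2 * b + n * a)) :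
    ∃ C : ℝ, 0 < C ∧ ∀ f : ℕ → Rn n → ℂ, OrthonormalHs s f → ∀ (J : Finset ℕ) (σ : ℝ), 0 < σ →
      volume {t | ENNReal.ofReal σ < eLpNorm (finDensity f J t) (expOf a) volume} ≤
        ENNReal.ofReal (C * J.card * σ ^ (-(1 / b))) := by
  have hn' : (2 : ℝ) ≤ n := by exact_mod_cast hn
  obtain ⟨δ, hδ0, hδa, hδb, hδ1, hδ2, hδ3⟩ : ∃ δ : ℝ, 0 < δ ∧ δ ≤ a ∧ δ < b ∧ δ < 1 - b ∧
      2 * n * δ ≤ (n - 1) * b - n * a ∧ (n + 2) * δ ≤ n - (2 * b + n * a) := by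
    set m := min a (min b (min (1 - b) (min ((n - 1) * b - n * a) (n - (2 * b + n * a))))) with hm
    have hm0 : 0 < m := by
      refine lt_min ha (lt_min hb (lt_min ?_ (lt_min ?_ ?_))) <;> linarith
    have m1 : m ≤ a := min_le_left _ _
    have m2' : m ≤ min b (min (1 - b) (min ((n - 1) * b - n * a) (n - (2 * b + n * a)))) :=
      min_le_right _ _
    have m2 : m ≤ b := m2'.trans (min_le_left _ _)
    have m3' := m2'.trans (min_le_right _ _)
    have m3 : m ≤ 1 - b := m3'.trans (min_le_left _ _)
    have m4' := m3'.trans (min_le_right _ _)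
    have m4 : m ≤ (n - 1) * b - n * a := m4'.trans (min_le_left _ _)
    have m5 : m ≤ n - (2 * b + n * a) := m4'.trans (min_le_right _ _)
    have hle : m / (4 * n) < m := div_lt_self hm0 (by linarith)
    have heq : 4 * n * (m / (4 * n)) = m := by field_simp
    have hpos : 0 < m / (4 * n) := by positivity
    refine ⟨m / (4 * n), hpos, by linarith, by linarith, by linarith, ?_, ?_⟩ <;> nlinarith
  set sgn : Bool → ℝ := fun e => if e then δ else -δ with hsgn
  have hsgn1 : ∀ e, -δ ≤ sgn e ∧ sgn e ≤ δ := by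
    intro e; cases e <;> simp [hsgn, hδ0.le]
  have adm : ∀ e : Bool × Bool, Admissible n (a + sgn e.1) (b + sgn e.2) := by
    intro e
    obtain ⟨u1, u2⟩ := hsgn1 e.1
    obtain ⟨v1, v2⟩ := hsgn1 e.2
    refine ⟨by linarith, by linarith, by linarith, ?_, ?_⟩
    · nlinarith
    · nlinarith
  set η : ℝ := δ / (6 * (1 + n / 2)) with hη
  have hη0 : 0 < η := by positivity
  have hηδ : 6 * η * (1 + n / 2) = δ := by rw [hη]; field_simp
  set S : ℝ := ∑' i, geo η i with hS
  have hS0 : 0 < S := (summable_geo hη0).tsum_pos (fun k => (geo_pos η k).le) 0 (geo_pos η 0)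
  choose K hK key using fun e : Bool × Bool =>
    exists_volume_volume_le_geo hn hb (adm e) hs hη0 (inv_pos.2 hS0)
  have hKS : ∀ e, K e ≤ ∑ e, K e := fun e =>
    Finset.single_le_sum (fun i _ => (hK i).le) (Finset.mem_univ e)
  have hKS0 : 0 < ∑ e, K e := (hK (true, true)).trans_le (hKS _)
  refine ⟨(∑ e, K e) * S * S, by positivity, fun f hf J σ hσ => ?_⟩
  have hτ : 0 < σ ^ (-(1 / b)) := by positivity
  set τ₀ : ℝ := σ ^ (-(1 / b)) with hτ₀
  obtain ⟨h, hB, hex⟩ := exists_scale_of_lt_finDensity hn (by linarith) hf hτ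
    (fun k => by have := geo_pos η k; positivity) (hasSum_geo_div hη0)
  set M : ℝ := σ * τ₀ ^ (-(n * a / 2)) with hM
  have hM0 : 0 < M := by positivity
  have hMa : M ^ (1 / a) = σ ^ (1 / a) * τ₀ ^ (-((n : ℝ) / 2)) := by
    rw [hM, Real.mul_rpow hσ.le (by positivity), ← Real.rpow_mul hτ.le]
    congr 2; field_simp
  set E : ℤ → ℤ → Set ℝ := fun k l => {t | ENNReal.ofReal ((S⁻¹ * geo η l) * (S⁻¹ * geo η k) / 2 *
          τ₀ ^ ((n : ℝ) / 2) * 2 ^ (-l)) <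
        volume {x | (S⁻¹ * geo η k) ^ 2 * (τ₀ * 2 ^ k) ^ (-s) *
          (σ * τ₀ ^ (-(n * a / 2)) * 2 ^ (l * a)) / gaussConst n ^ 2 ≤
        gaussMass (scale_pos hτ k) J (h k) t x}} with hE
  have hg0 : ∀ k, 0 < geo η k := geo_pos η
  have hsub : {t | ENNReal.ofReal σ < eLpNorm (finDensity f J t) (expOf a) volume} ⊆
      ⋃ k : ℤ, ⋃ l : ℤ, E k l := by
    intro t ht
    have hex1 : ∃ l : ℤ, ENNReal.ofReal (S⁻¹ * geo η l / 2 * τ₀ ^ ((n : ℝ) / 2) * 2 ^ (-l)) <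
        volume {x | M * 2 ^ (l * a) < finDensity f J t x} := by
      by_contra! hcon
      rw [Set.mem_ofPred_eq] at ht
      refine ht.not_ge ?_
      rw [eLpNorm_eq_lintegral_rpow_enorm_toReal (expOf_ne_zero a) (expOf_ne_top ha),
        toReal_expOf ha]
      have hI : ∫⁻ x, ‖finDensity f J t x‖ₑ ^ (1 / a) ≤ ENNReal.ofReal (σ ^ (1 / a)) := by
        simp_rw [Real.enorm_of_nonneg (finDensity_nonneg f J t _)]
        refine (lintegral_rpow_le_tsum ((continuous_finDensity f J).comp
          (Continuous.prodMk_right t)).measurable hM0 ha).trans ?_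
        have hterm : ∀ l : ℤ, ENNReal.ofReal (M ^ (1 / a) * 2 ^ (l + 1)) *
            volume {x | M * 2 ^ (l * a) < finDensity f J t x} ≤
            ENNReal.ofReal (σ ^ (1 / a) * (S⁻¹ * geo η l)) := by
          intro l
          refine (mul_le_mul_right (hcon l) _).trans ?_
          rw [← ENNReal.ofReal_mul (by positivity)]
          refine ENNReal.ofReal_le_ofReal (le_of_eq ?_)
          have e1 : τ₀ ^ (-((n : ℝ) / 2)) * τ₀ ^ ((n : ℝ) / 2) = 1 := by
            rw [← Real.rpow_add hτ]; simp
          have e2 : (2 : ℝ) ^ (l + 1) * 2 ^ (-l) = 2 := by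
            rw [← zpow_add₀ (by norm_num)]; simp
          rw [hMa]
          calc _ = σ ^ (1 / a) * (S⁻¹ * geo η l) / 2 *
                (τ₀ ^ (-((n : ℝ) / 2)) * τ₀ ^ ((n : ℝ) / 2)) * ((2 : ℝ) ^ (l + 1) * 2 ^ (-l)) := by
                ring
            _ = _ := by rw [e1, e2]; ring
        refine (ENNReal.tsum_le_tsum hterm).trans ?_
        rw [← ENNReal.ofReal_tsum_of_nonneg (fun k => by have := hg0 k; positivity)
          ((hasSum_geo_div hη0).summable.mul_left _), tsum_mul_left, (hasSum_geo_div hη0).tsum_eq,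
          mul_one]
      refine (ENNReal.rpow_le_rpow hI (by positivity)).trans ?_
      rw [ENNReal.ofReal_rpow_of_pos (by positivity), ← Real.rpow_mul hσ.le]
      simp [ha.ne']
    obtain ⟨l, hl⟩ := hex1
    have hex2 : ∃ k : ℤ, t ∈ E k l := by
      by_contra! hcon
      refine hl.not_ge ?_
      have hsub2 : {x | M * 2 ^ (l * a) < finDensity f J t x} ⊆ ⋃ k : ℤ,
          {x | (S⁻¹ * geo η k) ^ 2 * (τ₀ * 2 ^ k) ^ (-s) *
          (σ * τ₀ ^ (-(n * a / 2)) * 2 ^ (l * a)) / gaussConst n ^ 2 ≤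
            gaussMass (scale_pos hτ k) J (h k) t x} := by
        intro x hx
        obtain ⟨k, hk⟩ := hex J _ t x (by positivity) hx
        exact mem_iUnion.2 ⟨k, hk⟩
      refine (measure_mono hsub2).trans ((measure_iUnion_le _).trans
        ((ENNReal.tsum_le_tsum fun k => not_lt.1 (hcon k)).trans ?_))
      rw [← ENNReal.ofReal_tsum_of_nonneg (fun k => by have := hg0 k; have := hg0 l; positivity)]
      · refine ENNReal.ofReal_le_ofReal (le_of_eq ?_)
        have := ((hasSum_geo_div hη0).mul_left
          (S⁻¹ * geo η l / 2 * τ₀ ^ ((n : ℝ) / 2) * 2 ^ (-l))).tsum_eq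
        rw [mul_one] at this
        rw [← this]
        exact tsum_congr fun k => by ring
      · exact ((hasSum_geo_div hη0).mul_left
          (S⁻¹ * geo η l / 2 * τ₀ ^ ((n : ℝ) / 2) * 2 ^ (-l))).summable.congr fun k => by ring
    obtain ⟨k, hk⟩ := hex2
    exact mem_iUnion₂.2 ⟨k, l, hk⟩
  have hkl : ∀ k l : ℤ, volume (E k l) ≤
      ENNReal.ofReal ((∑ e, K e) * J.card * τ₀ * (geo η k * geo η l)) := by
    intro k l
    have hk0 := hg0 k
    have hl0 := hg0 l
    have hpick : ∀ y : ℝ, ∃ e : Bool, sgn e * y = -(δ * |y|) := by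
      intro y
      rcases le_total 0 y with hy | hy
      · exact ⟨false, by simp [hsgn, abs_of_nonneg hy]⟩
      · exact ⟨true, by simp [hsgn, abs_of_nonpos hy]⟩
    obtain ⟨e1, he1⟩ := hpick (l + k * (n / 2))
    obtain ⟨e2, he2⟩ := hpick k
    refine (key (e1, e2) σ hσ k l ?_ _ J (h k) (hB k)).trans (ENNReal.ofReal_le_ofReal ?_)
    · have e3 : (k : ℝ) * (b + sgn e2 - b) + (a + sgn e1 - a) * (l + k * (n / 2)) =
          -(δ * (|(k : ℝ)| + |(l + k * (n / 2) : ℝ)|)) := by linear_combination he1 + he2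
      have e4 : |(l : ℝ)| ≤ |(l + k * (n / 2) : ℝ)| + |(k : ℝ)| * (n / 2) := by
        have : (l : ℝ) = (l + k * (n / 2)) - k * (n / 2) := by ring
        calc |(l : ℝ)| = |(l + k * (n / 2) : ℝ) - k * (n / 2)| := by rw [← this]
          _ ≤ |(l + k * (n / 2) : ℝ)| + |(k : ℝ) * (n / 2)| := abs_sub _ _
          _ = _ := by rw [abs_mul, abs_of_nonneg (by positivity : (0 : ℝ) ≤ n / 2)]
      simp only
      rw [e3, neg_le_neg_iff, ← hηδ]
      have e5 : |(k : ℝ)| + |(l : ℝ)| ≤ (1 + n / 2) * (|(k : ℝ)| + |(l + k * (n / 2) : ℝ)|) := by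
        nlinarith [abs_nonneg (k : ℝ), abs_nonneg (l + k * (n / 2) : ℝ)]
      calc 6 * η * (|(k : ℝ)| + |(l : ℝ)|) ≤
          6 * η * ((1 + n / 2) * (|(k : ℝ)| + |(l + k * (n / 2) : ℝ)|)) := by gcongr
        _ = _ := by ring
    · have := hKS (e1, e2)
      gcongr
  refine (measure_mono hsub).trans ((measure_iUnion_le _).trans ((ENNReal.tsum_le_tsum
    fun k => (measure_iUnion_le _).trans (ENNReal.tsum_le_tsum (hkl k))).trans ?_))
  have hin : ∀ k, ∑' l, ENNReal.ofReal ((∑ e, K e) * J.card * τ₀ * (geo η k * geo η l)) =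
      ENNReal.ofReal ((∑ e, K e) * J.card * τ₀ * S * geo η k) := by
    intro k
    have hk0 := hg0 k
    rw [← ENNReal.ofReal_tsum_of_nonneg (fun l => by have := hg0 l; positivity)
      (((summable_geo hη0).mul_left _).mul_left _), tsum_mul_left, tsum_mul_left, ← hS]
    congr 1; ring
  simp_rw [hin]
  rw [← ENNReal.ofReal_tsum_of_nonneg (fun l => by have := hg0 l; positivity)
      ((summable_geo hη0).mul_left _), tsum_mul_left, ← hS]
  exact ENNReal.ofReal_le_ofReal (le_of_eq (by ring))

theorem eLpNorm_tsum_nat_le {X : Type*} [MeasurableSpace X] {μ : Measure X} {p : ℝ≥0∞} (hp : 1 ≤ p)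
    {g : ℕ → X → ℝ≥0∞} (hg : ∀ i, Measurable (g i)) :
    eLpNorm (fun x => ∑' i, g i x) p μ ≤ ∑' i, eLpNorm (g i) p μ := by
  rcases eq_or_ne p ∞ with rfl | hp'
  · simp only [eLpNorm_exponent_top]
    refine eLpNormEssSup_le_of_ae_enorm_bound ?_
    filter_upwards [ae_all_iff.2 fun i => enorm_ae_le_eLpNormEssSup (g i) μ] with x hx
    exact ENNReal.tsum_le_tsum hx
  have hp0 : p ≠ 0 := (zero_lt_one.trans_le hp).ne'
  have hr : 0 < p.toReal := ENNReal.toReal_pos hp0 hp'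
  have hfin : ∀ N, eLpNorm (∑ i ∈ Finset.range N, g i) p μ ≤ ∑' i, eLpNorm (g i) p μ := fun N =>
    (eLpNorm_sum_le (fun i _ => (hg i).aestronglyMeasurable) hp).trans (ENNReal.sum_le_tsum _)
  have hpow : ∀ (r : ℝ), 0 < r → ∀ u : ℕ → ℝ≥0∞, (⨆ i, u i) ^ r = ⨆ i, u i ^ r := fun r hr u =>
    (ENNReal.orderIsoRpow r hr).map_iSup u
  rw [eLpNorm_eq_lintegral_rpow_enorm_toReal hp0 hp']
  simp only [enorm_eq_self, ENNReal.tsum_eq_iSup_nat (f := fun i => g i _), hpow _ hr]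
  rw [lintegral_iSup, hpow _ (by positivity)]
  · refine iSup_le fun N => le_trans (le_of_eq ?_) (hfin N)
    rw [eLpNorm_eq_lintegral_rpow_enorm_toReal hp0 hp']
    simp
  · exact fun N => (Finset.measurable_fun_sum _ fun i _ => hg i).pow_const _
  · intro N M hNM x
    exact ENNReal.rpow_le_rpow (Finset.sum_le_sum_of_subset (Finset.range_mono hNM)) hr.le

theorem eLpNorm_tsum_le {X ι : Type*} [MeasurableSpace X] [Denumerable ι] {μ : Measure X} {p : ℝ≥0∞}
    (hp : 1 ≤ p) {g : ι → X → ℝ≥0∞} (hg : ∀ i, Measurable (g i)) :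
    eLpNorm (fun x => ∑' i, g i x) p μ ≤ ∑' i, eLpNorm (g i) p μ := by
  rw [← (Denumerable.eqv ι).symm.tsum_eq fun i => eLpNorm (g i) p μ]
  simp_rw [← (Denumerable.eqv ι).symm.tsum_eq fun i => g i _]
  exact eLpNorm_tsum_nat_le hp fun i => hg _

theorem le_tsum_two_zpow (x : ℝ≥0∞) :
    x ≤ ∑' k : ℤ, if (2 : ℝ≥0∞) ^ k < x then (2 : ℝ≥0∞) ^ (k + 1) else 0 := by
  rcases eq_or_ne x 0 with rfl | h0
  · exact zero_le
  have key : ∀ k : ℤ, (2 : ℝ≥0∞) ^ k < x → (2 : ℝ≥0∞) ^ (k + 1) ≤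
      ∑' k : ℤ, if (2 : ℝ≥0∞) ^ k < x then (2 : ℝ≥0∞) ^ (k + 1) else 0 := by
    intro k hk
    refine le_trans ?_ (ENNReal.le_tsum k)
    rw [if_pos hk]
  rcases eq_or_ne x ∞ with rfl | h1
  · refine le_of_forall_lt fun c hc => ?_
    rcases eq_or_ne c 0 with rfl | hc0
    · exact lt_of_lt_of_le (ENNReal.zpow_pos two_ne_zero ofNat_ne_top 1)
        (key 0 (ENNReal.zpow_lt_top two_ne_zero ofNat_ne_top 0))
    obtain ⟨m, hm⟩ := ENNReal.exists_mem_Ico_zpow hc0 hc.ne one_lt_two (ofNat_ne_top (n := 2))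
    exact hm.2.trans_le (key m (ENNReal.zpow_lt_top two_ne_zero ofNat_ne_top m))
  · obtain ⟨m, hm⟩ := ENNReal.exists_mem_Ioc_zpow h0 h1 one_lt_two (ofNat_ne_top (n := 2))
    exact hm.2.trans (key m hm.1)

theorem tsum_two_zpow_le (x : ℝ≥0∞) :
    ∑' k : ℤ, (if (2 : ℝ≥0∞) ^ k ≤ x then (2 : ℝ≥0∞) ^ k else 0) ≤ 2 * x := by
  have hpos : ∀ k : ℤ, 0 < (2 : ℝ≥0∞) ^ k := ENNReal.zpow_pos two_ne_zero ofNat_ne_top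
  rcases eq_or_ne x 0 with rfl | h0
  · simp [(hpos _).not_ge]
  rcases eq_or_ne x ∞ with rfl | h1
  · simp
  obtain ⟨m, hm⟩ := ENNReal.exists_mem_Ico_zpow h0 h1 one_lt_two (ofNat_ne_top (n := 2))
  have hle : ∀ k : ℤ, (if (2 : ℝ≥0∞) ^ k ≤ x then (2 : ℝ≥0∞) ^ k else 0) ≤
      2 ^ m * (if k ≤ m then (2 : ℝ≥0∞) ^ (k - m) else 0) := by
    intro k
    split_ifs with h2 h3
    · rw [← ENNReal.zpow_add two_ne_zero ofNat_ne_top]; simp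
    · refine absurd (h2.trans_lt hm.2) (not_lt.2 ?_)
      exact ENNReal.zpow_le_of_le one_le_two (by omega)
    · exact zero_le
    · exact zero_le
  refine (ENNReal.tsum_le_tsum hle).trans ?_
  rw [ENNReal.tsum_mul_left, ← (Equiv.subLeft m).tsum_eq]
  have hsum : ∑' k : ℤ, (if (Equiv.subLeft m) k ≤ m then (2 : ℝ≥0∞) ^ ((Equiv.subLeft m) k - m) else 0)
      = ∑' i : ℕ, (2 : ℝ≥0∞)⁻¹ ^ i := by
    rw [← (Nat.cast_injective (R := ℤ)).tsum_eq]
    · refine tsum_congr fun i => ?_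
      simp [ENNReal.zpow_neg, ENNReal.inv_pow]
    · intro k hk
      have : 0 ≤ k := by
        by_contra hcon
        exact hk (by simp; omega)
      exact ⟨k.toNat, by simp [this]⟩
  rw [hsum, ENNReal.tsum_geometric, ENNReal.one_sub_inv_two, inv_inv, mul_comm]
  gcongr
  exact hm.1

/-- The constant in the summation of weak-type bounds. -/
def weakConst (q : ℝ) : ℝ≥0∞ := ∑' j : ℤ, (2 : ℝ≥0∞) ^ (j : ℝ) * min 1 (2 ^ (-(j * q)))

theorem weakConst_ne_top {q : ℝ} (hq : 1 < q) : weakConst q ≠ ∞ := by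
  have hη : 0 < min 1 (q - 1) := lt_min one_pos (by linarith)
  refine ne_top_of_le_ne_top (summable_geo hη).tsum_ofReal_ne_top (ENNReal.tsum_le_tsum fun j => ?_)
  have h2 : ∀ y : ℝ, (2 : ℝ≥0∞) ^ y = ENNReal.ofReal (2 ^ y) := fun y => by
    rw [← ENNReal.ofReal_rpow_of_pos two_pos]; simp
  rcases le_total (j : ℝ) 0 with hj | hj
  · refine (mul_le_mul_right (min_le_left _ _) _).trans ?_
    rw [mul_one, h2, geo, abs_of_nonpos hj]
    refine ENNReal.ofReal_le_ofReal (Real.rpow_le_rpow_of_exponent_le one_le_two ?_)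
    nlinarith [min_le_left 1 (q - 1)]
  · refine (mul_le_mul_right (min_le_right _ _) _).trans ?_
    rw [← ENNReal.rpow_add _ _ two_ne_zero ofNat_ne_top, h2, geo, abs_of_nonneg hj]
    refine ENNReal.ofReal_le_ofReal (Real.rpow_le_rpow_of_exponent_le one_le_two ?_)
    nlinarith [min_le_right 1 (q - 1)]

theorem tsum_two_zpow_mul_min_le {b : ℝ} (hb : 0 < b) {A e : ℝ≥0∞} (hA : A ≠ ∞) (he : e ≠ ∞) :
    ∑' k : ℤ, (2 : ℝ≥0∞) ^ (k + 1) * min e ((A * 2 ^ (-k)) ^ (1 / b)) ≤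
      4 * weakConst (1 / b) * A * e ^ (1 - b) := by
  have hb' : 0 < 1 / b := by positivity
  rcases eq_or_ne A 0 with rfl | hA0
  · simp [ENNReal.zero_rpow_of_pos (inv_pos.2 hb)]
  rcases eq_or_ne e 0 with rfl | he0
  · simp
  have hz : ∀ k : ℤ, (2 : ℝ≥0∞) ^ k = 2 ^ (k : ℝ) := fun k => (ENNReal.rpow_intCast 2 k).symm
  have hadd : ∀ x y : ℝ, (2 : ℝ≥0∞) ^ (x + y) = 2 ^ x * 2 ^ y := fun x y =>
    ENNReal.rpow_add _ _ two_ne_zero ofNat_ne_top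
  set θ : ℝ≥0∞ := A * e ^ (-b) with hθ
  have heb0 : e ^ (-b) ≠ 0 := by simp [ENNReal.rpow_eq_zero_iff, he0, he]
  have hebt : e ^ (-b) ≠ ∞ := ENNReal.rpow_ne_top_of_ne_zero he0 he
  have hA' : A = θ * e ^ b := by
    rw [hθ, mul_assoc, ← ENNReal.rpow_add _ _ he0 he]; simp
  obtain ⟨m, hm⟩ := ENNReal.exists_mem_Ioc_zpow (x := θ) (mul_ne_zero hA0 heb0)
    (ENNReal.mul_ne_top hA hebt) one_lt_two (ofNat_ne_top (n := 2))
  have hterm : ∀ j : ℤ, (2 : ℝ≥0∞) ^ (m + 1 + j + 1) *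
      min e ((A * 2 ^ (-(m + 1 + j))) ^ (1 / b)) ≤
      (2 ^ m * 4 * e) * ((2 : ℝ≥0∞) ^ (j : ℝ) * min 1 (2 ^ (-(j * (1 / b))))) := by
    intro j
    have h1 : (A * 2 ^ (-(m + 1 + j))) ^ (1 / b) ≤ e * 2 ^ (-(j * (1 / b))) := by
      have h2 : A * 2 ^ (-(m + 1 + j)) ≤ e ^ b * 2 ^ (-(j : ℝ)) := by
        calc A * 2 ^ (-(m + 1 + j)) ≤ 2 ^ (m + 1) * e ^ b * 2 ^ (-(m + 1 + j)) := by
              rw [hA']; gcongr; exact hm.2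
          _ = e ^ b * (2 ^ (m + 1) * 2 ^ (-(m + 1 + j))) := by ring
          _ = e ^ b * 2 ^ (-(j : ℝ)) := by
              rw [hz, hz, ← hadd]; congr 2; push_cast; ring
      refine (ENNReal.rpow_le_rpow h2 hb'.le).trans (le_of_eq ?_)
      rw [ENNReal.mul_rpow_of_nonneg _ _ hb'.le, ← ENNReal.rpow_mul, ← ENNReal.rpow_mul,
        mul_one_div_cancel hb.ne', ENNReal.rpow_one, neg_mul]
    have h3 : (2 : ℝ≥0∞) ^ (m + 1 + j + 1) = 2 ^ m * 4 * 2 ^ (j : ℝ) := by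
      have h4 : (4 : ℝ≥0∞) = 2 ^ (2 : ℝ) := by
        rw [show (2 : ℝ) = ((2 : ℕ) : ℝ) by norm_num, ENNReal.rpow_natCast]; norm_num
      rw [hz, hz, h4, ← hadd, ← hadd]
      congr 1; push_cast; ring
    calc _ ≤ (2 ^ m * 4 * 2 ^ (j : ℝ)) * min (e * 1) (e * 2 ^ (-(j * (1 / b)))) := by
          rw [h3]; gcongr; rw [mul_one]
      _ = _ := by rw [← mul_min]; ring
  rw [← (Equiv.addLeft (m + 1)).tsum_eq]
  refine (ENNReal.tsum_le_tsum hterm).trans ?_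
  rw [ENNReal.tsum_mul_left, ← weakConst]
  calc 2 ^ m * 4 * e * weakConst (1 / b) ≤ θ * 4 * e * weakConst (1 / b) := by
        gcongr; exact hm.1.le
    _ = 4 * weakConst (1 / b) * A * (e ^ (-b) * e ^ (1 : ℝ)) := by
        rw [hθ, ENNReal.rpow_one]; ring
    _ = _ := by rw [← ENNReal.rpow_add _ _ he0 he]; congr 2; ring

theorem exists_measurable_ge_setLIntegral_le {X : Type*} [MeasurableSpace X] (μ : Measure X)
    {b : ℝ} (hb : 0 < b) {A : ℝ≥0∞} (hA : A ≠ ∞) {G : X → ℝ≥0∞}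
    (hG : ∀ k : ℤ, μ {x | (2 : ℝ≥0∞) ^ k < G x} ≤ (A * 2 ^ (-k)) ^ (1 / b)) :
    ∃ G' : X → ℝ≥0∞, Measurable G' ∧ G ≤ G' ∧ ∀ F, MeasurableSet F → μ F ≠ ∞ →
      ∫⁻ x in F, G' x ∂μ ≤ 4 * weakConst (1 / b) * A * μ F ^ (1 - b) := by
  set M : ℤ → Set X := fun k => toMeasurable μ {x | (2 : ℝ≥0∞) ^ k < G x} with hM
  have hMm : ∀ k, MeasurableSet (M k) := fun k => measurableSet_toMeasurable _ _
  have hmeas : ∀ k : ℤ, Measurable ((M k).indicator fun _ => (2 : ℝ≥0∞) ^ (k + 1)) := fun k =>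
    measurable_const.indicator (hMm k)
  refine ⟨fun x => ∑' k : ℤ, (M k).indicator (fun _ => (2 : ℝ≥0∞) ^ (k + 1)) x,
    Measurable.tsum hmeas, ?_, ?_⟩
  · intro x
    refine (le_tsum_two_zpow (G x)).trans (ENNReal.tsum_le_tsum fun k => ?_)
    split_ifs with h
    · rw [indicator_of_mem (subset_toMeasurable μ _ h)]
    · exact zero_le
  · intro F hF hFt
    rw [lintegral_tsum fun k => (hmeas k).aemeasurable]
    refine (ENNReal.tsum_le_tsum fun k => ?_).trans (tsum_two_zpow_mul_min_le hb hA hFt)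
    rw [lintegral_indicator_const (hMm k), Measure.restrict_apply (hMm k)]
    gcongr
    refine le_min (measure_mono inter_subset_right) ((measure_mono inter_subset_left).trans ?_)
    rw [hM, measure_toMeasurable]
    exact hG k

theorem mul_measure_lt_tsum_rpow_le {X ι : Type*} [MeasurableSpace X] [Countable ι] {μ : Measure X}
    [SigmaFinite μ] {b : ℝ} (hb : 0 < b) {A : ι → ℝ≥0∞} (hA : ∀ i, A i ≠ ∞) {G : ι → X → ℝ≥0∞}
    (hG : ∀ i (k : ℤ), μ {x | (2 : ℝ≥0∞) ^ k < G i x} ≤ (A i * 2 ^ (-k)) ^ (1 / b))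
    {σ : ℝ≥0∞} (hσ0 : σ ≠ 0) (hσ : σ ≠ ∞) :
    σ * μ {x | σ < ∑' i, G i x} ^ b ≤ 4 * weakConst (1 / b) * ∑' i, A i := by
  choose G' hm hle hbound using fun i => exists_measurable_ge_setLIntegral_le μ hb (hA i) (hG i)
  set E : Set X := {x | σ < ∑' i, G' i x} with hE
  have hEm : MeasurableSet E := measurableSet_lt measurable_const (Measurable.tsum hm)
  have hb' : 0 < 1 / b := by positivity
  set R : ℝ≥0∞ := 4 * weakConst (1 / b) * ∑' i, A i with hR
  have hsub : {x | σ < ∑' i, G i x} ⊆ E := fun x hx =>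
    lt_of_lt_of_le hx (ENNReal.tsum_le_tsum fun i => hle i x)
  have hfin : ∀ F, MeasurableSet F → F ⊆ E → μ F ≠ ∞ → μ F ≤ (R / σ) ^ (1 / b) := by
    intro F hF hFE hFt
    rcases eq_or_ne (μ F) 0 with h0 | h0
    · rw [h0]; exact zero_le
    have h1 : σ * μ F ≤ R * μ F ^ (1 - b) := by
      calc σ * μ F = ∫⁻ x in F, σ ∂μ := by rw [setLIntegral_const]
        _ ≤ ∫⁻ x in F, ∑' i, G' i x ∂μ := setLIntegral_mono (Measurable.tsum hm) fun x hx =>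
            (show σ < _ from hFE hx).le
        _ = ∑' i, ∫⁻ x in F, G' i x ∂μ := lintegral_tsum fun i => (hm i).aemeasurable
        _ ≤ ∑' i, 4 * weakConst (1 / b) * A i * μ F ^ (1 - b) :=
            ENNReal.tsum_le_tsum fun i => hbound i F hF hFt
        _ = _ := by rw [ENNReal.tsum_mul_right, ENNReal.tsum_mul_left]
    have h2 : σ * μ F ^ b ≤ R := by
      calc σ * μ F ^ b = (σ * μ F) * μ F ^ (b - 1) := by
            rw [mul_assoc]
            nth_rewrite 2 [← ENNReal.rpow_one (μ F)]
            rw [← ENNReal.rpow_add _ _ h0 hFt]; congr 2; ring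
        _ ≤ R * μ F ^ (1 - b) * μ F ^ (b - 1) := by gcongr
        _ = R := by
            rw [mul_assoc, ← ENNReal.rpow_add _ _ h0 hFt]; simp
    have h3 : μ F ^ b ≤ R / σ := by
      rw [ENNReal.le_div_iff_mul_le (Or.inl hσ0) (Or.inl hσ), mul_comm]; exact h2
    calc μ F = (μ F ^ b) ^ (1 / b) := by
          rw [← ENNReal.rpow_mul, mul_one_div_cancel hb.ne', ENNReal.rpow_one]
      _ ≤ _ := ENNReal.rpow_le_rpow h3 hb'.le
  have hEle : μ E ≤ (R / σ) ^ (1 / b) := by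
    rw [← Measure.iSup_restrict_spanningSets]
    refine iSup_le fun i => ?_
    rw [Measure.restrict_apply hEm]
    exact hfin _ (hEm.inter (measurableSet_spanningSets μ i)) inter_subset_left
      (ne_top_of_le_ne_top (measure_spanningSets_lt_top μ i).ne (measure_mono inter_subset_right))
  calc σ * μ {x | σ < ∑' i, G i x} ^ b ≤ σ * ((R / σ) ^ (1 / b)) ^ b := by
        gcongr; exact (measure_mono hsub).trans hEle
    _ = R := by
        rw [← ENNReal.rpow_mul, one_div_mul_cancel hb.ne', ENNReal.rpow_one,
          ENNReal.mul_div_cancel hσ0 hσ]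

theorem two_zpow_eq_ofReal (k : ℤ) : (2 : ℝ≥0∞) ^ k = ENNReal.ofReal (2 ^ k) := by
  rw [← ENNReal.rpow_intCast, ← Real.rpow_intCast, ← ENNReal.ofReal_rpow_of_pos two_pos]
  simp

theorem enorm_two_zpow (k : ℤ) : ‖(2 : ℝ) ^ k‖ₑ = (2 : ℝ≥0∞) ^ k := by
  rw [Real.enorm_of_nonneg (by positivity), two_zpow_eq_ofReal]

theorem eLpNorm_two_zpow_mul {X : Type*} [MeasurableSpace X] (μ : Measure X) (p : ℝ≥0∞) (k : ℤ)
    (g : X → ℝ) : eLpNorm (fun x => (2 : ℝ) ^ k * g x) p μ = 2 ^ k * eLpNorm g p μ := by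
  rw [← enorm_two_zpow]
  exact eLpNorm_const_smul ((2 : ℝ) ^ k) g p μ

theorem seqLor_one (b : ℝ) (lam : ℕ → ℝ) :
    seqLor b 1 lam = ∑' j : ℕ, ((j : ℝ≥0∞) + 1) ^ (b - 1) * seqRearr lam j := by
  simp only [seqLor, ENNReal.rpow_one, div_one]
  refine tsum_congr fun j => ?_
  have h0 : (j : ℝ≥0∞) + 1 ≠ 0 := by simp
  have h1 : (j : ℝ≥0∞) + 1 ≠ ∞ := by simp
  rw [ENNReal.rpow_sub _ _ h0 h1, ENNReal.rpow_one, div_eq_mul_inv]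
  ring

theorem le_seqRearr {lam : ℕ → ℝ} {r : ℝ≥0∞} {j : ℕ}
    (h : (j : ℝ≥0∞) < Measure.count {i : ℕ | r < ENNReal.ofReal |lam i|}) : r ≤ seqRearr lam j := by
  refine le_sInf fun u hu => ?_
  by_contra! hcon
  refine h.not_ge (le_trans (measure_mono fun i hi => ?_) hu)
  exact hcon.trans hi

theorem natCast_rpow_le_sum {b : ℝ} (hb1 : b < 1) (N : ℕ) (hN : N ≠ 0) :
    (N : ℝ≥0∞) ^ b ≤ ∑ j ∈ Finset.range N, ((j : ℝ≥0∞) + 1) ^ (b - 1) := by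
  have h0 : (N : ℝ≥0∞) ≠ 0 := by exact_mod_cast hN
  calc (N : ℝ≥0∞) ^ b = ∑ j ∈ Finset.range N, (N : ℝ≥0∞) ^ (b - 1) := by
        rw [Finset.sum_const, Finset.card_range, nsmul_eq_mul]
        nth_rewrite 2 [← ENNReal.rpow_one (N : ℝ≥0∞)]
        rw [← ENNReal.rpow_add _ _ h0 (by simp)]
        congr 1; ring
    _ ≤ _ := Finset.sum_le_sum fun j hj => by
        rw [← neg_sub, ENNReal.rpow_neg, ENNReal.rpow_neg, ENNReal.inv_le_inv]
        refine ENNReal.rpow_le_rpow ?_ (by linarith)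
        exact_mod_cast Finset.mem_range.1 hj

theorem finite_setOf_lt {b : ℝ} (hb : 0 < b) (hb1 : b < 1) {lam : ℕ → ℝ} (hlam : seqLor b 1 lam ≠ ∞)
    {r : ℝ≥0∞} (hr : r ≠ 0) : {i : ℕ | r < ENNReal.ofReal |lam i|}.Finite := by
  rw [← Measure.count_apply_lt_top]
  by_contra hcon
  have htop : Measure.count {i : ℕ | r < ENNReal.ofReal |lam i|} = ∞ := not_lt_top.1 hcon
  have hbound : ∀ N : ℕ, N ≠ 0 → (N : ℝ≥0∞) ≤ (seqLor b 1 lam / r) ^ (1 / b) := by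
    intro N hN
    have h1 : (N : ℝ≥0∞) ^ b * r ≤ seqLor b 1 lam := by
      rw [seqLor_one]
      refine le_trans ?_ (ENNReal.sum_le_tsum (Finset.range N))
      refine (mul_le_mul_left (natCast_rpow_le_sum hb1 N hN) r).trans ?_
      rw [Finset.sum_mul]
      refine Finset.sum_le_sum fun j _ => ?_
      gcongr
      exact le_seqRearr (by rw [htop]; simp)
    have h2 : (N : ℝ≥0∞) ^ b ≤ seqLor b 1 lam / r := by
      rcases eq_or_ne r ∞ with rfl | hrt
      · have : (N : ℝ≥0∞) ^ b ≠ 0 := by simp [ENNReal.rpow_eq_zero_iff, hN]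
        rw [ENNReal.mul_top this, top_le_iff] at h1
        exact absurd h1 hlam
      · rwa [ENNReal.le_div_iff_mul_le (Or.inl hr) (Or.inl hrt)]
    calc (N : ℝ≥0∞) = ((N : ℝ≥0∞) ^ b) ^ (1 / b) := by
          rw [← ENNReal.rpow_mul, mul_one_div_cancel hb.ne', ENNReal.rpow_one]
      _ ≤ _ := ENNReal.rpow_le_rpow h2 (by positivity)
  obtain ⟨N, hN⟩ := ENNReal.exists_nat_gt (r := (seqLor b 1 lam / r) ^ (1 / b))
    (ENNReal.rpow_ne_top_of_nonneg (by positivity) (ENNReal.div_ne_top hlam hr))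
  exact (hbound (N + 1) (by omega)).not_gt (hN.trans_le (by push_cast; exact le_self_add))

theorem tsum_two_zpow_mul_card_rpow_le {b : ℝ} (hb : 0 < b) (hb1 : b < 1) {lam : ℕ → ℝ}
    {E : ℤ → Finset ℕ} (hE : ∀ k i, i ∈ E k ↔ (2 : ℝ≥0∞) ^ k < ENNReal.ofReal |lam i|) :
    ∑' k : ℤ, (2 : ℝ≥0∞) ^ k * ((E k).card : ℝ≥0∞) ^ b ≤ 2 * seqLor b 1 lam := by
  have hcount : ∀ k, Measure.count {i : ℕ | (2 : ℝ≥0∞) ^ k < ENNReal.ofReal |lam i|} =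
      ((E k).card : ℝ≥0∞) := by
    intro k
    rw [← Measure.count_apply_finset (E k)]
    congr 1; ext i; simp [hE]
  have h1 : ∀ k, (2 : ℝ≥0∞) ^ k * ((E k).card : ℝ≥0∞) ^ b ≤
      ∑' j : ℕ, ((j : ℝ≥0∞) + 1) ^ (b - 1) *
        (if (2 : ℝ≥0∞) ^ k ≤ seqRearr lam j then (2 : ℝ≥0∞) ^ k else 0) := by
    intro k
    rcases eq_or_ne (E k).card 0 with h0 | h0
    · simp [h0, hb]
    refine le_trans ?_ (ENNReal.sum_le_tsum (Finset.range (E k).card))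
    rw [mul_comm]
    refine (mul_le_mul_left (natCast_rpow_le_sum hb1 _ h0) _).trans ?_
    rw [Finset.sum_mul]
    refine Finset.sum_le_sum fun j hj => ?_
    rw [if_pos]
    refine le_seqRearr ?_
    rw [hcount]
    exact_mod_cast Finset.mem_range.1 hj
  refine (ENNReal.tsum_le_tsum h1).trans ?_
  rw [ENNReal.tsum_comm, seqLor_one, ← ENNReal.tsum_mul_left]
  refine ENNReal.tsum_le_tsum fun j => ?_
  rw [ENNReal.tsum_mul_left]
  calc _ ≤ ((j : ℝ≥0∞) + 1) ^ (b - 1) * (2 * seqRearr lam j) := by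
        gcongr; exact tsum_two_zpow_le _
    _ = _ := by ring

theorem enorm_density_le {n : ℕ} (lam : ℕ → ℝ) (f : ℕ → Rn n → ℂ) {E : ℤ → Finset ℕ}
    (hE : ∀ k i, i ∈ E k ↔ (2 : ℝ≥0∞) ^ k < ENNReal.ofReal |lam i|) (t : ℝ) (x : Rn n) :
    ‖density lam f t x‖ₑ ≤ ∑' k : ℤ, ‖(2 : ℝ) ^ (k + 1) * finDensity f (E k) t x‖ₑ := by
  have hfin : ∀ k, ‖(2 : ℝ) ^ (k + 1) * finDensity f (E k) t x‖ₑ =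
      ∑' j : ℕ, (if (2 : ℝ≥0∞) ^ k < ENNReal.ofReal |lam j| then (2 : ℝ≥0∞) ^ (k + 1) else 0) *
        ‖schrodinger (f j) t x‖ₑ ^ 2 := by
    intro k
    rw [enorm_mul, enorm_two_zpow, Real.enorm_of_nonneg (finDensity_nonneg f _ t x), finDensity,
      ENNReal.ofReal_sum_of_nonneg (fun _ _ => by positivity), Finset.mul_sum,
      tsum_eq_sum (s := E k)]
    · refine Finset.sum_congr rfl fun j hj => ?_
      rw [if_pos ((hE k j).1 hj), ENNReal.ofReal_pow (norm_nonneg _), ofReal_norm]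
    · intro j hj
      rw [if_neg (fun h => hj ((hE k j).2 h)), zero_mul]
  simp_rw [hfin]
  rw [ENNReal.tsum_comm]
  simp_rw [ENNReal.tsum_mul_right]
  rw [density, density2]
  refine enorm_tsum_le_tsum_enorm.trans (ENNReal.tsum_le_tsum fun j => ?_)
  rw [enorm_mul, enorm_pow, enorm_norm]
  gcongr
  rw [← Real.enorm_abs, Real.enorm_of_nonneg (abs_nonneg _)]
  exact le_tsum_two_zpow _

theorem mixedWeakLp_density_le {n : ℕ} {a b C : ℝ} (ha1 : a ≤ 1) (hb : 0 < b)
    (hb1 : b < 1) (hC : 0 < C) {f : ℕ → Rn n → ℂ} {lam : ℕ → ℝ} (hlam : seqLor b 1 lam ≠ ∞)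
    (hf : ∀ (J : Finset ℕ) (σ : ℝ), 0 < σ →
      volume {t | ENNReal.ofReal σ < eLpNorm (finDensity f J t) (expOf a) volume} ≤
        ENNReal.ofReal (C * J.card * σ ^ (-(1 / b)))) :
    mixedWeakLp (expOf b) (expOf a) (density lam f) ≤
      16 * weakConst (1 / b) * ENNReal.ofReal (C ^ b) * seqLor b 1 lam := by
  have hp : 1 ≤ expOf a := by
    rw [expOf, ENNReal.one_le_inv]; exact ENNReal.ofReal_le_one.2 ha1
  have hb' : 0 < 1 / b := by positivity
  set E : ℤ → Finset ℕ := fun k => (finite_setOf_lt hb hb1 hlam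
    (ENNReal.zpow_pos two_ne_zero ofNat_ne_top k).ne').toFinset with hEdef
  have hE : ∀ k i, i ∈ E k ↔ (2 : ℝ≥0∞) ^ k < ENNReal.ofReal |lam i| := by
    intro k i; simp [hEdef]
  set G : ℤ → ℝ → ℝ≥0∞ := fun k t =>
    eLpNorm (fun x => (2 : ℝ) ^ (k + 1) * finDensity f (E k) t x) (expOf a) volume with hG
  set A : ℤ → ℝ≥0∞ := fun k => ENNReal.ofReal (2 ^ (k + 1) * (C * (E k).card) ^ b) with hA
  have hle : ∀ t, eLpNorm (density lam f t) (expOf a) volume ≤ ∑' k, G k t := by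
    intro t
    calc eLpNorm (density lam f t) (expOf a) volume ≤
        eLpNorm (fun x => ∑' k : ℤ, ‖(2 : ℝ) ^ (k + 1) * finDensity f (E k) t x‖ₑ)
          (expOf a) volume := eLpNorm_mono_enorm fun x => by
            rw [enorm_eq_self]; exact enorm_density_le lam f hE t x
      _ ≤ ∑' k : ℤ, eLpNorm (fun x => ‖(2 : ℝ) ^ (k + 1) * finDensity f (E k) t x‖ₑ)
          (expOf a) volume := eLpNorm_tsum_le hp fun k =>
            (continuous_const.mul ((continuous_finDensity f (E k)).comp
              (Continuous.prodMk_right t))).enorm.measurable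
      _ = _ := tsum_congr fun k => eLpNorm_enorm _
  have hGA : ∀ (i k : ℤ), volume {t | (2 : ℝ≥0∞) ^ k < G i t} ≤ (A i * 2 ^ (-k)) ^ (1 / b) := by
    intro i k
    have hset : {t | (2 : ℝ≥0∞) ^ k < G i t} ⊆
        {t | ENNReal.ofReal (2 ^ (k - (i + 1))) <
          eLpNorm (finDensity f (E i) t) (expOf a) volume} := by
      intro t ht
      rw [Set.mem_ofPred_eq] at ht ⊢
      by_contra! hcon
      refine ht.not_ge ?_
      simp only [hG]
      rw [eLpNorm_two_zpow_mul]
      refine (mul_le_mul_right hcon _).trans (le_of_eq ?_)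
      rw [← two_zpow_eq_ofReal, ← ENNReal.zpow_add two_ne_zero ofNat_ne_top]
      congr 1; ring
    refine (measure_mono hset).trans ((hf (E i) _ (by positivity)).trans (le_of_eq ?_))
    rw [hA, two_zpow_eq_ofReal, ← ENNReal.ofReal_mul (by positivity), ENNReal.ofReal_rpow_of_nonneg (by positivity)
      hb'.le]
    congr 1
    have e1 : (2 : ℝ) ^ (i + 1) * (C * (E i).card) ^ b * 2 ^ (-k) =
        (C * (E i).card) ^ b * (2 ^ (k - (i + 1)))⁻¹ := by
      rw [← zpow_neg, show -(k - (i + 1)) = i + 1 + -k by ring, zpow_add₀ two_ne_zero (i + 1)]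
      ring
    rw [e1, Real.mul_rpow (by positivity) (by positivity), ← Real.rpow_mul (by positivity),
      mul_one_div_cancel hb.ne', Real.rpow_one, Real.inv_rpow (by positivity), Real.rpow_neg
      (by positivity)]
  have hAsum : ∑' k, A k ≤ 4 * ENNReal.ofReal (C ^ b) * seqLor b 1 lam := by
    have h1 : ∀ k, A k = 2 * ENNReal.ofReal (C ^ b) * ((2 : ℝ≥0∞) ^ k * ((E k).card : ℝ≥0∞) ^ b) := by
      intro k
      have h3 : ((E k).card : ℝ≥0∞) ^ b = ENNReal.ofReal (((E k).card : ℝ) ^ b) := by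
        rw [← ENNReal.ofReal_rpow_of_nonneg (by positivity) hb.le, ENNReal.ofReal_natCast]
      have h5 : (2 : ℝ≥0∞) = ENNReal.ofReal 2 := by simp
      simp only [hA]
      rw [h3, two_zpow_eq_ofReal, h5, ← ENNReal.ofReal_mul (by positivity), ← ENNReal.ofReal_mul (by positivity),
        ← ENNReal.ofReal_mul (by positivity)]
      congr 1
      rw [Real.mul_rpow hC.le (by positivity), zpow_add_one₀ two_ne_zero]; ring
    simp_rw [h1]
    rw [ENNReal.tsum_mul_left]
    calc _ ≤ 2 * ENNReal.ofReal (C ^ b) * (2 * seqLor b 1 lam) := by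
          gcongr; exact tsum_two_zpow_mul_card_rpow_le hb hb1 hE
      _ = _ := by ring
  rw [mixedWeakLp, lor, if_neg (expOf_ne_top hb), if_pos rfl, toReal_expOf hb, one_div_one_div]
  refine iSup₂_le fun σ hσ => ?_
  calc _ ≤ ENNReal.ofReal σ * volume {t | ENNReal.ofReal σ < ∑' k, G k t} ^ b := by
        gcongr with t
        exact hle t
    _ ≤ 4 * weakConst (1 / b) * ∑' k, A k :=
        mul_measure_lt_tsum_rpow_le hb (fun k => ENNReal.ofReal_ne_top) hGA
          (ENNReal.ofReal_pos.2 hσ).ne' ENNReal.ofReal_ne_top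
    _ ≤ 4 * weakConst (1 / b) * (4 * ENNReal.ofReal (C ^ b) * seqLor b 1 lam) := by gcongr
    _ = _ := by ring

/-- Restricted weak-type frequency-global estimates at the critical
summability exponent `α = q`, for `(1/p, 1/q)` in the interior of `OCDA` or on the
open segment `(O, C)` (i.e. `p = ∞`, `1 < q < ∞`).  Here `(a, b) = (1/p, 1/q)` and
`2s = n - (2/q + n/p)`. -/
theorem restricted_weak_type_critical (n : ℕ) (hn : 2 ≤ n) (a b s : ℝ)
    (hab : IntOCDA n a b ∨ (a = 0 ∧ 0 < b ∧ b < 1))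
    (hs : 2 * s = n - (2 * b + n * a)) :
    ∃ C : ℝ, 0 < C ∧ ∀ (f : ℕ → Rn n → ℂ) (lam : ℕ → ℝ),
      OrthonormalHs s f → seqLor b 1 lam ≠ ∞ →
      mixedWeakLp (expOf b) (expOf a) (density lam f)
        ≤ ENNReal.ofReal C * seqLor b 1 lam := by
  have hn' : (2 : ℝ) ≤ n := by exact_mod_cast hn
  have ⟨ha1, hb0, hb1, C, hC, key⟩ : a ≤ 1 ∧ 0 < b ∧ b < 1 ∧ ∃ C : ℝ, 0 < C ∧
      ∀ f : ℕ → Rn n → ℂ, OrthonormalHs s f → ∀ (J : Finset ℕ) (σ : ℝ), 0 < σ →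
      volume {t | ENNReal.ofReal σ < eLpNorm (finDensity f J t) (expOf a) volume} ≤
        ENNReal.ofReal (C * J.card * σ ^ (-(1 / b))) := by
    rcases hab with ⟨⟨ha0, ha1⟩, ⟨hb0, hb1⟩, h1, h2⟩ | ⟨rfl, hb0, hb1⟩
    · refine ⟨ha1.le, hb0, hb1, volume_lt_eLpNorm_finDensity hn ha0 hb0 hb1 ?_ h2 hs⟩
      rw [div_mul_eq_mul_div, div_lt_iff₀ (by linarith)] at h1
      linarith
    · exact ⟨zero_le_one, hb0, hb1,
        volume_lt_eLpNorm_finDensity_top hn hb0 hb1 (by rw [hs]; ring)⟩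
  have hq : 1 < 1 / b := by rw [lt_div_iff₀ hb0]; linarith
  set K : ℝ≥0∞ := 16 * weakConst (1 / b) * ENNReal.ofReal (C ^ b) with hK
  have hKt : K ≠ ∞ := ENNReal.mul_ne_top (ENNReal.mul_ne_top ofNat_ne_top (weakConst_ne_top hq))
    ENNReal.ofReal_ne_top
  refine ⟨K.toReal + 1, by positivity, fun f lam hf hlam => ?_⟩
  refine (mixedWeakLp_density_le ha1 hb0 hb1 hC hlam (key f hf)).trans ?_
  gcongr
  rw [← hK, ← ENNReal.ofReal_toReal hKt]
  exact ENNReal.ofReal_le_ofReal (by simp)
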